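/- Assume k = dim(affine span of K) ∈ {1,…,d−1} (so d_H = k), p > 1 and δ, δ' ≥ 0. (i) If d − k + pδ − 2p > 0, then the optimal Rellich constant satisfies ν_p(Ω) ≤ ((p−1)(d−k)(d−k+pδ−2p)/p²)^p. (ii) If in addition the dimension at infinity satisfies k_∞ = k and d − k + p·min(δ,δ') − 2p > 0, then ν_p(Ω) ≤ ((p−1)(d−k)(d−k+p·min(δ,δ')−2p)/p²)^p. (iii) If moreover δ = δ' ∈ [0,2), k_∞ = k and d − k + pδ − 2p > 0, then ν_p(Ω) = ((p−1)(d−k)(d−k+pδ−2p)/p²)^p. -/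

import Mathlib

open MeasureTheory Set Filter
open scoped RealInnerProductSpace

noncomputable section

/-- The weight `c_Ω = c ∘ d_Γ` with `c(s) = s^δ (1+s)^(δ'-δ)`. -/
def cWeight {d : ℕ} (K : Set (EuclideanSpace ℝ (Fin d))) (δ δ' : ℝ)
    (x : EuclideanSpace ℝ (Fin d)) : ℝ :=
  Metric.infDist x K ^ δ * (1 + Metric.infDist x K) ^ (δ' - δ)

/-- The Laplacian `Δφ = Σ_k ∂_k² φ`. -/
def lapl {d : ℕ} (φ : EuclideanSpace ℝ (Fin d) → ℝ) (x : EuclideanSpace ℝ (Fin d)) : ℝ :=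
  ∑ i, iteratedFDeriv ℝ 2 φ x (fun _ => EuclideanSpace.single i (1 : ℝ))

/-- The weighted operator `H = -div(c_Ω ∇)`. -/
def Hop {d : ℕ} (K : Set (EuclideanSpace ℝ (Fin d))) (δ δ' : ℝ)
    (φ : EuclideanSpace ℝ (Fin d) → ℝ) (x : EuclideanSpace ℝ (Fin d)) : ℝ :=
  -(cWeight K δ δ' x) * lapl φ x - ⟪gradient (cWeight K δ δ') x, gradient φ x⟫

/-- The optimal Rellich constant `ν_p(Ω)` for `Ω = ℝ^d \ K`. -/
def nuP (d : ℕ) (p δ δ' : ℝ) (K : Set (EuclideanSpace ℝ (Fin d))) : ℝ :=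
  sInf { r : ℝ | ∃ φ : EuclideanSpace ℝ (Fin d) → ℝ,
    ContDiff ℝ 2 φ ∧ HasCompactSupport φ ∧ tsupport φ ⊆ Kᶜ ∧ φ ≠ 0 ∧
    r = (∫ x in Kᶜ, |Hop K δ δ' φ x| ^ p) /
        (∫ x in Kᶜ, (cWeight K δ δ' x * Metric.infDist x K ^ (-(2 : ℝ))) ^ p * |φ x| ^ p) }

theorem rel_proj_exists {E : Type*} [NormedAddCommGroup E] [InnerProductSpace ℝ E] [ProperSpace E]
    (K : Set E) (hKne : K.Nonempty) (hKcl : IsClosed K) (hKconv : Convex ℝ K) :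
    ∃ P : E → E, (∀ x, P x ∈ K) ∧ (∀ x, Metric.infDist x K = ‖x - P x‖) ∧
      (∀ x, ∀ w ∈ K, ⟪x - P x, w - P x⟫ ≤ 0) ∧ LipschitzWith 1 P := by
  choose P hP hd using fun x => hKcl.exists_infDist_eq_dist hKne x
  have hvar : ∀ x, ∀ w ∈ K, ⟪x - P x, w - P x⟫ ≤ 0 := by
    intro x
    rw [← norm_eq_iInf_iff_real_inner_le_zero hKconv (hP x)]
    have : Nonempty K := hKne.to_subtype
    have h1 := hd x
    rw [Metric.infDist_eq_iInf, dist_eq_norm] at h1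
    rw [← h1]
    simp [dist_eq_norm]
  refine ⟨P, hP, fun x => by rw [hd x, dist_eq_norm], hvar, ?_⟩
  refine LipschitzWith.of_dist_le_mul fun x y => ?_
  have h1 := hvar x (P y) (hP y)
  have h2 := hvar y (P x) (hP x)
  have h3 : ‖P x - P y‖ ^ 2 ≤ ⟪x - y, P x - P y⟫ := by
    rw [← real_inner_self_eq_norm_sq]
    have e1 : P y - P x = -(P x - P y) := by abel
    rw [e1, inner_neg_right] at h1
    have e2 : ⟪x - y, P x - P y⟫ - ⟪P x - P y, P x - P y⟫ = ⟪x - P x, P x - P y⟫ - ⟪y - P y, P x - P y⟫ := by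
      rw [← inner_sub_left, ← inner_sub_left]; congr 1; abel
    linarith
  have h4 := real_inner_le_norm (x - y) (P x - P y)
  rw [dist_eq_norm, dist_eq_norm]
  simp only [NNReal.coe_one, one_mul]
  by_contra hc
  push Not at hc
  nlinarith [norm_nonneg (x - y), norm_nonneg (P x - P y)]

theorem rel_hasFDeriv_sq {E : Type*} [NormedAddCommGroup E] [InnerProductSpace ℝ E]
    (K : Set E) (P : E → E) (hP : ∀ x, P x ∈ K) (hd : ∀ x, Metric.infDist x K = ‖x - P x‖)
    (hL : LipschitzWith 1 P) (x : E) :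
    HasFDerivAt (fun y => Metric.infDist y K ^ 2) ((2 : ℝ) • innerSL ℝ (x - P x)) x := by
  rw [hasFDerivAt_iff_isLittleO_nhds_zero]
  have hbd : ∀ h : E, ‖Metric.infDist (x + h) K ^ 2 - Metric.infDist x K ^ 2
      - ((2 : ℝ) • innerSL ℝ (x - P x)) h‖ ≤ 5 * ‖h‖ ^ 2 := by
    intro h
    have a1 : Metric.infDist (x + h) K ≤ ‖x + h - P x‖ := by
      rw [← dist_eq_norm]; exact Metric.infDist_le_dist_of_mem (hP x)
    have a2 : Metric.infDist x K ≤ ‖x - P (x + h)‖ := by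
      rw [← dist_eq_norm]; exact Metric.infDist_le_dist_of_mem (hP _)
    have n1 : (0:ℝ) ≤ Metric.infDist (x + h) K := Metric.infDist_nonneg
    have n2 : (0:ℝ) ≤ Metric.infDist x K := Metric.infDist_nonneg
    have b1 : Metric.infDist (x + h) K ^ 2 ≤ ‖x + h - P x‖ ^ 2 := by gcongr
    have b2 : Metric.infDist x K ^ 2 ≤ ‖x - P (x + h)‖ ^ 2 := by gcongr
    have c1 : ‖x + h - P x‖ ^ 2 = ‖x - P x‖ ^ 2 + 2 * ⟪x - P x, h⟫ + ‖h‖ ^ 2 := by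
      rw [← norm_add_sq_real]; congr 2; abel
    have c2 : ‖x - P (x + h)‖ ^ 2 = ‖x + h - P (x + h)‖ ^ 2 - 2 * ⟪x + h - P (x + h), h⟫ + ‖h‖ ^ 2 := by
      rw [← norm_sub_sq_real]; congr 2; abel
    have c3 : ⟪x + h - P (x + h), h⟫ = ⟪x - P x, h⟫ + ‖h‖ ^ 2 - ⟪P (x + h) - P x, h⟫ := by
      rw [← real_inner_self_eq_norm_sq, ← inner_add_left, ← inner_sub_left]; congr 1; abel
    have c4 : |⟪P (x + h) - P x, h⟫| ≤ ‖h‖ ^ 2 := by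
      refine (abs_real_inner_le_norm _ _).trans ?_
      have := hL.dist_le_mul (x + h) x
      rw [dist_eq_norm, dist_eq_norm] at this
      simp at this
      rw [pow_two]; gcongr
    have hh := abs_le.1 c4
    rw [← hd] at c1
    rw [← hd] at c2
    rw [Real.norm_eq_abs, abs_le]
    simp only [smul_apply, innerSL_apply_apply, smul_eq_mul]
    constructor <;> nlinarith
  refine Asymptotics.IsBigO.trans_isLittleO (g := fun h : E => ‖h‖ ^ 2) ?_ ?_
  · refine Asymptotics.IsBigO.of_bound 5 (Eventually.of_forall fun h => ?_)
    refine (hbd h).trans ?_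
    simp
  · have := (Asymptotics.isLittleO_norm_pow_id (E' := E) (n := 2) (by norm_num))
    exact this

theorem rel_hasFDeriv_rpow {E : Type*} [NormedAddCommGroup E] [InnerProductSpace ℝ E]
    (K : Set E) (hKcl : IsClosed K) (hKne : K.Nonempty)
    (P : E → E) (hP : ∀ x, P x ∈ K) (hd : ∀ x, Metric.infDist x K = ‖x - P x‖)
    (hL : LipschitzWith 1 P) (γ : ℝ) (x : E) (hx : x ∉ K) :
    HasFDerivAt (fun y => Metric.infDist y K ^ γ)
      ((γ * Metric.infDist x K ^ (γ - 2)) • innerSL ℝ (x - P x)) x := by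
  have hpos : 0 < Metric.infDist x K := (hKcl.notMem_iff_infDist_pos hKne).1 hx
  have h := (rel_hasFDeriv_sq K P hP hd hL x).rpow_const (p := γ / 2) (Or.inl (by positivity))
  have e1 : (fun y => (Metric.infDist y K ^ 2) ^ (γ / 2)) = fun y => Metric.infDist y K ^ γ := by
    funext y
    rw [← Real.rpow_natCast_mul Metric.infDist_nonneg]
    congr 1; push_cast; ring
  rw [e1] at h
  convert h using 1
  rw [smul_smul]
  congr 1
  rw [← Real.rpow_natCast_mul Metric.infDist_nonneg]
  have : ((2:ℕ):ℝ) * (γ / 2 - 1) = γ - 2 := by push_cast; ring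
  rw [this]; ring


theorem rel_ibp {d : ℕ} {f u : EuclideanSpace ℝ (Fin d) → ℝ} {C : NNReal} (hf : LipschitzWith C f)
    (hu : ContDiff ℝ 1 u) (hc : HasCompactSupport u) (v : EuclideanSpace ℝ (Fin d)) :
    Integrable (fun x => f x * fderiv ℝ u x v) ∧
    ∫ x, f x * fderiv ℝ u x v = - ∫ x, lineDeriv ℝ f x v * u x := by
  obtain ⟨D, hD⟩ := hu.lipschitzWith_of_hasCompactSupport hc (by norm_num)
  constructor
  · refine Continuous.integrable_of_hasCompactSupport ?_ ?_
    · exact hf.continuous.mul ((hu.continuous_fderiv (by norm_num)).clm_apply continuous_const)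
    · exact (hc.fderiv_apply (𝕜 := ℝ) v).mul_left
  · rw [hf.integral_lineDeriv_mul_eq hD hc v, ← integral_neg]
    congr 1; funext x
    rw [((hu.differentiable (by norm_num)) x).lineDeriv_eq_fderiv, map_neg]
    ring

/-- divergence inequality -/
theorem rel_div_ineq {d : ℕ} (K : Set (EuclideanSpace ℝ (Fin d)))
    (P : EuclideanSpace ℝ (Fin d) → EuclideanSpace ℝ (Fin d)) (hP : ∀ x, P x ∈ K)
    (hL : LipschitzWith 1 P) (u : EuclideanSpace ℝ (Fin d) → ℝ) (hu : ContDiff ℝ 1 u)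
    (hc : HasCompactSupport u) (hu0 : ∀ x, 0 ≤ u x) :
    ((d : ℝ) - Module.finrank ℝ (affineSpan ℝ K).direction) * ∫ x, u x ≤
      - ∫ x, fderiv ℝ u x (x - P x) := by
  set W := (affineSpan ℝ K).direction with hW
  set b := stdOrthonormalBasis ℝ W with hb
  set a := P 0 with ha
  have hmem : ∀ x, P x - a ∈ W := fun x => by
    have := AffineSubspace.vsub_mem_direction (subset_affineSpan ℝ K (hP x))
      (subset_affineSpan ℝ K (hP 0))
    simpa using this
  have hdec : ∀ x, P x - a = ∑ j, ⟪(b j : EuclideanSpace ℝ (Fin d)), P x - a⟫ • (b j : EuclideanSpace ℝ (Fin d)) := by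
    intro x
    have h := b.sum_repr' (⟨P x - a, hmem x⟩ : W)
    have h2 := congrArg (Subtype.val) h
    simp only [Submodule.coe_sum, Submodule.coe_smul, Submodule.coe_inner] at h2
    exact h2.symm
  have hbn : ∀ j, ‖(b j : EuclideanSpace ℝ (Fin d))‖ = 1 := fun j => by
    exact (Submodule.coe_norm (b j)).symm.trans (b.norm_eq_one j)
  have hLj : ∀ j, LipschitzWith 1 (fun x => ⟪(b j : EuclideanSpace ℝ (Fin d)), P x - a⟫) := by
    intro j
    refine LipschitzWith.of_dist_le_mul fun x y => ?_
    rw [Real.dist_eq, ← inner_sub_right]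
    refine (abs_real_inner_le_norm _ _).trans ?_
    rw [hbn, one_mul]
    have := hL.dist_le_mul x y
    rw [dist_eq_norm] at this
    simpa using this
  have hLi : ∀ i : Fin d, LipschitzWith 1 (fun x : EuclideanSpace ℝ (Fin d) => x i) := by
    intro i
    refine LipschitzWith.of_dist_le_mul fun x y => ?_
    rw [Real.dist_eq, dist_eq_norm]
    have := PiLp.norm_apply_le (x - y) i
    simpa using this
  have hfd : ∀ x, fderiv ℝ u x (x - P x) = ∑ i, x i * fderiv ℝ u x (EuclideanSpace.single i 1)
      - 1 * fderiv ℝ u x a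
      - ∑ j, ⟪(b j : EuclideanSpace ℝ (Fin d)), P x - a⟫ * fderiv ℝ u x (b j) := by
    intro x
    have e : x - P x = x - a - (P x - a) := by abel
    rw [e, map_sub, map_sub]
    congr 1
    · rw [one_mul]; congr 1
      have := (EuclideanSpace.basisFun (Fin d) ℝ).sum_repr x
      have h2 := congrArg (fderiv ℝ u x) this
      rw [← h2]
      simp [map_sum]
    · conv_lhs => rw [hdec x]
      simp [map_sum]
  have hI1 := fun i => rel_ibp (hLi i) hu hc (EuclideanSpace.single i 1)
  have hI2 := rel_ibp (LipschitzWith.const (1:ℝ) : LipschitzWith 0 (fun _ : EuclideanSpace ℝ (Fin d) => (1:ℝ))) hu hc a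
  have hI3 := fun j => rel_ibp (hLj j) hu hc (b j)
  have hui : Integrable u := hu.continuous.integrable_of_hasCompactSupport hc
  simp_rw [hfd]
  rw [integral_sub, integral_sub, integral_finsetSum, integral_finsetSum]
  rotate_left
  · exact fun j _ => (hI3 j).1
  · exact fun i _ => (hI1 i).1
  · exact integrable_finsetSum _ fun i _ => (hI1 i).1
  · exact hI2.1
  · exact (integrable_finsetSum _ fun i _ => (hI1 i).1).sub hI2.1
  · exact integrable_finsetSum _ fun i _ => (hI3 i).1
  have s1 : ∀ i, ∫ x, x i * fderiv ℝ u x (EuclideanSpace.single i 1) = - ∫ x, u x := by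
    intro i
    rw [(hI1 i).2]
    congr 2; funext x
    have : HasLineDerivAt ℝ (fun x : EuclideanSpace ℝ (Fin d) => x i) 1 x (EuclideanSpace.single i 1) := by
      have := (((EuclideanSpace.proj i : EuclideanSpace ℝ (Fin d) →L[ℝ] ℝ)).hasFDerivAt (x := x)).hasLineDerivAt (EuclideanSpace.single i 1)
      simpa using this
    rw [this.lineDeriv, one_mul]
  have s2 : ∫ x, 1 * fderiv ℝ u x a = 0 := by
    rw [hI2.2]
    have : ∀ x, lineDeriv ℝ (fun _ : EuclideanSpace ℝ (Fin d) => (1:ℝ)) x a = 0 := by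
      intro x; simp [lineDeriv]
    simp [this]
  have s3 : ∀ j, - ∫ x, u x ≤ ∫ x, ⟪(b j : EuclideanSpace ℝ (Fin d)), P x - a⟫ * fderiv ℝ u x (b j) := by
    intro j
    rw [(hI3 j).2]
    apply neg_le_neg
    by_cases hi : Integrable (fun x => lineDeriv ℝ (fun x => ⟪(b j : EuclideanSpace ℝ (Fin d)), P x - a⟫) x (b j) * u x)
    · refine integral_mono hi hui fun x => ?_
      have h1 := norm_lineDeriv_le_of_lipschitz ℝ (hLj j) (x₀ := x) (v := (b j : EuclideanSpace ℝ (Fin d)))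
      rw [hbn, Real.norm_eq_abs] at h1
      have h2 := (abs_le.1 h1).2
      have h3 := hu0 x
      simp only [NNReal.coe_one, mul_one] at h2
      exact mul_le_of_le_one_left h3 h2
    · rw [integral_undef hi]
      exact integral_nonneg hu0
  have s4 := Finset.sum_le_sum (s := Finset.univ) fun j _ => s3 j
  simp only [Finset.sum_const, Finset.card_univ, Fintype.card_fin, nsmul_eq_mul] at s4
  rw [Finset.sum_congr rfl (fun i _ => s1 i), s2]
  simp only [Finset.sum_const, Finset.card_univ, Fintype.card_fin, nsmul_eq_mul]
  linarith

theorem rel_contDiff_off {E : Type*} [NormedAddCommGroup E] [NormedSpace ℝ E] {K T : Set E}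
    {f : E → ℝ} (n : ℕ) (hT : IsCompact T) (hTK : T ⊆ Kᶜ)
    (hf : ∀ x, x ∉ K → ContDiffAt ℝ n f x) (h0 : ∀ x, x ∉ T → f x = 0) :
    ContDiff ℝ n f ∧ HasCompactSupport f := by
  refine ⟨?_, HasCompactSupport.intro hT h0⟩
  rw [contDiff_iff_contDiffAt]
  intro x
  by_cases hx : x ∈ T
  · exact hf x (hTK hx)
  · have : f =ᶠ[nhds x] fun _ => 0 := by
      filter_upwards [hT.isClosed.isOpen_compl.mem_nhds hx] with y hy using h0 y hy
    exact contDiffAt_const.congr_of_eventuallyEq this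

theorem rel_continuous_off {E : Type*} [NormedAddCommGroup E] [NormedSpace ℝ E] {K T : Set E}
    {f : E → ℝ} (hT : IsCompact T) (hTK : T ⊆ Kᶜ)
    (hf : ∀ x, x ∉ K → ContinuousAt f x) (h0 : ∀ x, x ∉ T → f x = 0) :
    Continuous f ∧ HasCompactSupport f := by
  refine ⟨?_, HasCompactSupport.intro hT h0⟩
  rw [continuous_iff_continuousAt]
  intro x
  by_cases hx : x ∈ T
  · exact hf x (hTK hx)
  · have : f =ᶠ[nhds x] fun _ => 0 := by
      filter_upwards [hT.isClosed.isOpen_compl.mem_nhds hx] with y hy using h0 y hy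
    exact continuousAt_const.congr this.symm

theorem rel_contDiffAt_rpow {E : Type*} [NormedAddCommGroup E] [InnerProductSpace ℝ E]
    (K : Set E) (hKcl : IsClosed K) (hKne : K.Nonempty)
    (P : E → E) (hP : ∀ x, P x ∈ K) (hd : ∀ x, Metric.infDist x K = ‖x - P x‖)
    (hL : LipschitzWith 1 P) (γ : ℝ) (x : E) (hx : x ∉ K) :
    ContDiffAt ℝ 1 (fun y => Metric.infDist y K ^ γ) x := by
  rw [contDiffAt_one_iff]
  refine ⟨fun x => (γ * Metric.infDist x K ^ (γ - 2)) • innerSL ℝ (x - P x), Kᶜ,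
    hKcl.isOpen_compl.mem_nhds hx, ?_, fun y hy => rel_hasFDeriv_rpow K hKcl hKne P hP hd hL γ y hy⟩
  refine ContinuousOn.smul (f := fun x => γ * Metric.infDist x K ^ (γ - 2))
    (g := fun x => innerSL ℝ (x - P x)) (ContinuousOn.mul continuousOn_const ?_) ?_
  · refine ContinuousOn.rpow_const (Metric.continuous_infDist_pt (s := K)).continuousOn fun y hy => Or.inl ?_
    exact ((hKcl.notMem_iff_infDist_pos hKne).1 hy).ne'
  · have := hL.continuous
    exact ((innerSL ℝ (E := E)).continuous.comp (continuous_id.sub this)).continuousOn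

theorem rel_Hop_eq {d : ℕ} (K : Set (EuclideanSpace ℝ (Fin d)))
    (hKcl : IsClosed K) (hKne : K.Nonempty)
    (P : EuclideanSpace ℝ (Fin d) → EuclideanSpace ℝ (Fin d)) (hP : ∀ x, P x ∈ K)
    (hd : ∀ x, Metric.infDist x K = ‖x - P x‖)
    (hL : LipschitzWith 1 P) (δ : ℝ) (φ : EuclideanSpace ℝ (Fin d) → ℝ)
    (x : EuclideanSpace ℝ (Fin d)) (hx : x ∉ K) :
    Hop K δ δ φ x = - Metric.infDist x K ^ δ * lapl φ x
      - δ * Metric.infDist x K ^ (δ - 2) * fderiv ℝ φ x (x - P x) := by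
  have h1 : cWeight K δ δ = fun y => Metric.infDist y K ^ δ := by
    funext y; simp [cWeight]
  have h2 : gradient (fun y => Metric.infDist y K ^ δ) x
      = (δ * Metric.infDist x K ^ (δ - 2)) • (x - P x) := by
    apply HasGradientAt.gradient
    rw [hasGradientAt_iff_hasFDerivAt]
    have e : InnerProductSpace.toDual ℝ _ ((δ * Metric.infDist x K ^ (δ - 2)) • (x - P x)) =
        (δ * Metric.infDist x K ^ (δ - 2)) • innerSL ℝ (x - P x) := by
      rw [map_smul]; rfl
    rw [e]
    exact rel_hasFDeriv_rpow K hKcl hKne P hP hd hL δ x hx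
  rw [Hop, h1, h2, real_inner_comm, gradient, InnerProductSpace.toDual_symm_apply]
  simp

theorem rel_lapl_eq {d : ℕ} (φ : EuclideanSpace ℝ (Fin d) → ℝ) (hφ : ContDiff ℝ 2 φ)
    (x : EuclideanSpace ℝ (Fin d)) :
    lapl φ x = ∑ i, fderiv ℝ (fun y => fderiv ℝ φ y (EuclideanSpace.single i 1)) x
      (EuclideanSpace.single i 1) := by
  unfold lapl
  refine Finset.sum_congr rfl fun i _ => ?_
  rw [iteratedFDeriv_two_apply]
  have h : DifferentiableAt ℝ (fderiv ℝ φ) x :=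
    ((hφ.fderiv_right (m := 1) (by norm_num)).differentiable (by norm_num)) x
  rw [fderiv_clm_apply h (differentiableAt_const _)]
  simp

/-- core inequality with smooth nonlinearity -/
theorem rel_core {d : ℕ} (K : Set (EuclideanSpace ℝ (Fin d)))
    (hKcl : IsClosed K) (hKne : K.Nonempty)
    (P : EuclideanSpace ℝ (Fin d) → EuclideanSpace ℝ (Fin d)) (hP : ∀ x, P x ∈ K)
    (hd : ∀ x, Metric.infDist x K = ‖x - P x‖)
    (hL : LipschitzWith 1 P) (δ σ lam : ℝ) (φ : EuclideanSpace ℝ (Fin d) → ℝ)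
    (hφ : ContDiff ℝ 2 φ) (hφc : HasCompactSupport φ) (hφK : tsupport φ ⊆ Kᶜ)
    (f G : ℝ → ℝ) (hf : ContDiff ℝ 1 f) (hG : ContDiff ℝ 1 G) (hf0 : f 0 = 0) (hG0 : G 0 = 0)
    (hGn : ∀ t, 0 ≤ G t) (hf' : ∀ t, 0 ≤ deriv f t)
    (hGd : ∀ t, deriv G t = - σ * f t + 2 * lam * (t * deriv f t)) :
    0 ≤ ∫ x, (Hop K δ δ φ x * Metric.infDist x K ^ σ * f (φ x) -
      Metric.infDist x K ^ (δ + σ - 2) * (((d : ℝ) - Module.finrank ℝ (affineSpan ℝ K).direction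
        + (δ + σ - 2)) * G (φ x) - lam ^ 2 * (deriv f (φ x) * φ x ^ 2))) := by
  set a := δ + σ with ha
  set m := (d : ℝ) - Module.finrank ℝ (affineSpan ℝ K).direction with hm
  have hr : ∀ x, x ∉ K → 0 < Metric.infDist x K := fun x hx => (hKcl.notMem_iff_infDist_pos hKne).1 hx
  have hT : IsCompact (tsupport φ) := hφc
  have hφ0 : ∀ x, x ∉ tsupport φ → φ x = 0 := fun x hx => image_eq_zero_of_notMem_tsupport hx
  have hφd0 : ∀ x, x ∉ tsupport φ → fderiv ℝ φ x = 0 := fun x hx => by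
    have := support_fderiv_subset ℝ (f := φ)
    by_contra hne
    exact hx (this hne)
  have hrC := rel_contDiffAt_rpow K hKcl hKne P hP hd hL
  have hrD := rel_hasFDeriv_rpow K hKcl hKne P hP hd hL
  have hφ1 : ContDiff ℝ 1 φ := hφ.of_le (by norm_num)
  have hφ2 : ContDiff ℝ 1 (fderiv ℝ φ) := hφ.fderiv_right (by norm_num)
  have hφe : ∀ v, ContDiff ℝ 1 (fun y => fderiv ℝ φ y v) := fun v => hφ2.clm_apply contDiff_const
  have hφD : ∀ x, HasFDerivAt φ (fderiv ℝ φ x) x := fun x => (hφ1.differentiable (by norm_num) x).hasFDerivAt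
  have hfD : ∀ t, HasDerivAt f (deriv f t) t := fun t => (hf.differentiable (by norm_num) t).hasDerivAt
  have hGD : ∀ t, HasDerivAt G (deriv G t) t := fun t => (hG.differentiable (by norm_num) t).hasDerivAt
  have hLz : LipschitzWith 0 (fun _ : EuclideanSpace ℝ (Fin d) => (1:ℝ)) := LipschitzWith.const 1
  -- the vector field
  set Wf : Fin d → EuclideanSpace ℝ (Fin d) → ℝ := fun i y =>
    Metric.infDist y K ^ a * (f (φ y) * fderiv ℝ φ y (EuclideanSpace.single i 1)) with hWf
  have hWC : ∀ i, ContDiff ℝ 1 (Wf i) ∧ HasCompactSupport (Wf i) := fun i =>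
    rel_contDiff_off (K := K) 1 hT hφK (fun x hx => (hrC a x hx).mul
      ((hf.comp hφ1).contDiffAt.mul (hφe _).contDiffAt)) (fun x hx => by simp [hWf, hφd0 x hx])
  have hWI : ∀ i, Integrable (fun x => fderiv ℝ (Wf i) x (EuclideanSpace.single i 1)) ∧
      ∫ x, fderiv ℝ (Wf i) x (EuclideanSpace.single i 1) = 0 := fun i => by
    have := rel_ibp hLz (hWC i).1 (hWC i).2 (EuclideanSpace.single i 1)
    simpa [lineDeriv] using this
  have hWd : ∀ i x, x ∉ K → fderiv ℝ (Wf i) x (EuclideanSpace.single i 1) =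
      a * Metric.infDist x K ^ (a - 2) * (x - P x) i * (f (φ x) * fderiv ℝ φ x (EuclideanSpace.single i 1))
      + Metric.infDist x K ^ a * (deriv f (φ x) * fderiv ℝ φ x (EuclideanSpace.single i 1) ^ 2
        + f (φ x) * fderiv ℝ (fun y => fderiv ℝ φ y (EuclideanSpace.single i 1)) x (EuclideanSpace.single i 1)) := by
    intro i x hx
    have h1 := (hrD a x hx).mul (((hfD (φ x)).comp_hasFDerivAt x (hφD x)).mul
      ((hφe (EuclideanSpace.single i 1)).differentiable (by norm_num) x).hasFDerivAt)
    have h2 : fderiv ℝ (Wf i) x = _ := h1.fderiv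
    rw [h2]
    have h4 : ⟪x - P x, EuclideanSpace.single i (1:ℝ)⟫ = (x - P x) i := by
      rw [real_inner_comm, EuclideanSpace.inner_single_left]; simp
    generalize x - P x = V at *
    simp [h4]
    ring
  -- divergence inequality
  set u : EuclideanSpace ℝ (Fin d) → ℝ := fun y => Metric.infDist y K ^ (a - 2) * G (φ y) with hu
  have huC : ContDiff ℝ 1 u ∧ HasCompactSupport u :=
    rel_contDiff_off (K := K) 1 hT hφK (fun x hx => (hrC _ x hx).mul
      (hG.comp hφ1).contDiffAt) (fun x hx => by simp [hu, hφ0 x hx, hG0])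
  have hdiv := rel_div_ineq K P hP hL u huC.1 huC.2
    (fun x => mul_nonneg (Real.rpow_nonneg Metric.infDist_nonneg _) (hGn _))
  have hud : ∀ x, x ∉ K → fderiv ℝ u x (x - P x) =
      (a - 2) * u x + Metric.infDist x K ^ (a - 2) * (deriv G (φ x) * fderiv ℝ φ x (x - P x)) := by
    intro x hx
    have h1 := (hrD (a - 2) x hx).mul ((hGD (φ x)).comp_hasFDerivAt x (hφD x))
    have h2 : fderiv ℝ u x = _ := h1.fderiv
    have hrx := hr x hx
    have h3 : Metric.infDist x K ^ (a - 2) = Metric.infDist x K ^ (a - 2 - 2) * Metric.infDist x K ^ 2 := by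
      rw [← Real.rpow_natCast, ← Real.rpow_add hrx]; congr 1; push_cast; ring
    have h4 := hd x
    rw [h2]
    generalize x - P x = V at *
    simp [hu, real_inner_self_eq_norm_sq]
    rw [← h4, h3]
    ring
  have hui : Integrable u := huC.1.continuous.integrable_of_hasCompactSupport huC.2
  have hudI : Integrable (fun x => fderiv ℝ u x (x - P x)) := by
    refine Continuous.integrable_of_hasCompactSupport ?_ ?_
    · exact (huC.1.continuous_fderiv (by norm_num)).clm_apply (continuous_id.sub hL.continuous)
    · refine (huC.2.fderiv (𝕜 := ℝ)).mono ?_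
      intro x hx
      simp only [Function.mem_support] at hx ⊢
      contrapose! hx
      simp [hx]
  -- combine
  have hWs : Integrable (fun x => ∑ i, fderiv ℝ (Wf i) x (EuclideanSpace.single i 1)) :=
    integrable_finsetSum _ (fun i _ => (hWI i).1)
  have hZ : ∫ x, (∑ i, fderiv ℝ (Wf i) x (EuclideanSpace.single i 1)) = 0 := by
    rw [integral_finsetSum _ (fun i _ => (hWI i).1)]
    simp [(fun i => (hWI i).2)]
  have hΨ : 0 ≤ ∫ x, (-(∑ i, fderiv ℝ (Wf i) x (EuclideanSpace.single i 1))
      - fderiv ℝ u x (x - P x) - m * u x) := by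
    rw [integral_sub, integral_sub, integral_neg, hZ, integral_const_mul]
    · linarith
    · exact hWs.neg
    · exact hudI
    · exact hWs.neg.sub hudI
    · exact hui.const_mul m
  by_cases hΦ : Integrable (fun x => (Hop K δ δ φ x * Metric.infDist x K ^ σ * f (φ x) -
      Metric.infDist x K ^ (a - 2) * ((m + (a - 2)) * G (φ x) - lam ^ 2 * (deriv f (φ x) * φ x ^ 2))))
  swap
  · rw [integral_undef hΦ]
  refine hΨ.trans (integral_mono ((hWs.neg.sub hudI).sub (hui.const_mul m)) hΦ fun x => ?_)
  by_cases hxT : x ∈ tsupport φ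
  swap
  · have hnh : (tsupport φ)ᶜ ∈ nhds x := hT.isClosed.isOpen_compl.mem_nhds hxT
    have w0 : ∀ i, fderiv ℝ (Wf i) x = 0 := fun i => by
      have : Wf i =ᶠ[nhds x] fun _ => 0 := by
        filter_upwards [hnh] with y hy
        simp [hWf, hφd0 y hy]
      rw [this.fderiv_eq]; simp
    have u0 : fderiv ℝ u x = 0 := by
      have : u =ᶠ[nhds x] fun _ => 0 := by
        filter_upwards [hnh] with y hy
        simp [hu, hφ0 y hy, hG0]
      rw [this.fderiv_eq]; simp
    have u00 : u x = 0 := by simp [hu, hφ0 x hxT, hG0]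
    simp only [w0, u0, u00, hφ0 x hxT, hG0, hf0]
    simp
  have hxK : x ∉ K := hφK hxT
  have hrx := hr x hxK
  have hH := rel_Hop_eq K hKcl hKne P hP hd hL δ φ x hxK
  rw [rel_lapl_eq φ hφ x] at hH
  have hud' := hud x hxK
  have hDs : fderiv ℝ φ x (x - P x) = ∑ i, (x - P x) i * fderiv ℝ φ x (EuclideanSpace.single i 1) := by
    have := (EuclideanSpace.basisFun (Fin d) ℝ).sum_repr (x - P x)
    have h2 := congrArg (fderiv ℝ φ x) this
    rw [← h2]
    simp [map_sum]
  have hCS := Finset.sum_mul_sq_le_sq_mul_sq Finset.univ (fun i => (x - P x) i)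
    (fun i => fderiv ℝ φ x (EuclideanSpace.single i 1))
  rw [← hDs] at hCS
  have hV2 : ∑ i, (x - P x) i ^ 2 = Metric.infDist x K ^ 2 := by
    rw [hd, EuclideanSpace.norm_sq_eq]; simp
  rw [hV2] at hCS
  have hWsum : ∑ i, fderiv ℝ (Wf i) x (EuclideanSpace.single i 1) =
      a * Metric.infDist x K ^ (a - 2) * f (φ x) * fderiv ℝ φ x (x - P x)
      + Metric.infDist x K ^ a * (deriv f (φ x) * ∑ i, fderiv ℝ φ x (EuclideanSpace.single i 1) ^ 2
      + f (φ x) * ∑ i, fderiv ℝ (fun y => fderiv ℝ φ y (EuclideanSpace.single i 1)) x (EuclideanSpace.single i 1)) := by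
    rw [Finset.sum_congr rfl (fun i _ => hWd i x hxK), hDs, Finset.sum_add_distrib, ← Finset.mul_sum,
      Finset.sum_add_distrib, ← Finset.mul_sum, ← Finset.mul_sum]
    congr 1
    rw [Finset.mul_sum]
    exact Finset.sum_congr rfl fun i _ => by ring
  have e1 : Metric.infDist x K ^ δ * Metric.infDist x K ^ σ = Metric.infDist x K ^ a := by
    rw [← Real.rpow_add hrx]
  have e2 : Metric.infDist x K ^ (δ - 2) * Metric.infDist x K ^ σ = Metric.infDist x K ^ (a - 2) := by
    rw [← Real.rpow_add hrx]; congr 1; rw [ha]; ring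
  have e3 : Metric.infDist x K ^ a = Metric.infDist x K ^ (a - 2) * Metric.infDist x K ^ 2 := by
    rw [← Real.rpow_natCast, ← Real.rpow_add hrx]; congr 1; push_cast; ring
  have hpos := Real.rpow_nonneg hrx.le (a - 2)
  have hfx := hf' (φ x)
  have hGx := hGd (φ x)
  have hux : u x = Metric.infDist x K ^ (a - 2) * G (φ x) := rfl
  simp only [hWsum, hH, hud', hGx]
  rw [hux]
  rw [e3] at e1 ⊢
  generalize fderiv ℝ φ x (x - P x) = D at *
  generalize ∑ i, fderiv ℝ (fun y => fderiv ℝ φ y (EuclideanSpace.single i 1)) x (EuclideanSpace.single i 1) = Lp at *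
  generalize ∑ i, fderiv ℝ φ x (EuclideanSpace.single i 1) ^ 2 = S2 at *
  generalize Metric.infDist x K ^ (a - 2) = R at *
  generalize Metric.infDist x K ^ (δ - 2) = Rd2 at *
  generalize Metric.infDist x K ^ δ = Rd at *
  generalize Metric.infDist x K ^ σ = Rs at *
  generalize Metric.infDist x K = r at *
  generalize deriv f (φ x) = f1 at *
  have key : 0 ≤ R * f1 * ((lam * φ x + D) ^ 2 + (r ^ 2 * S2 - D ^ 2)) :=
    mul_nonneg (mul_nonneg hpos hfx) (add_nonneg (sq_nonneg _) (by linarith))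
  have e4 : (-Rd * Lp - δ * Rd2 * D) * Rs * f (φ x) = (-(R * r ^ 2) * Lp - δ * R * D) * f (φ x) := by
    rw [← e1, ← e2]; ring
  rw [e4]
  have : δ = a - σ := by rw [ha]; ring
  rw [this]
  nlinarith [key]

def relf (p ε t : ℝ) : ℝ := t * (t ^ 2 + ε) ^ (p / 2 - 1)
def relF (p ε t : ℝ) : ℝ := ((t ^ 2 + ε) ^ (p / 2) - ε ^ (p / 2)) / p
def relG (p σ lam ε t : ℝ) : ℝ := -σ * relF p ε t + 2 * lam * (t * relf p ε t - relF p ε t)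

theorem relf_hasDerivAt {p ε : ℝ} (hε : 0 < ε) (t : ℝ) :
    HasDerivAt (relf p ε) ((t ^ 2 + ε) ^ (p / 2 - 2) * ((p - 1) * t ^ 2 + ε)) t := by
  have hy : 0 < t ^ 2 + ε := by positivity
  have h1 : HasDerivAt (fun t : ℝ => t ^ 2 + ε) (2 * t) t := by
    simpa using (hasDerivAt_pow 2 t).add_const ε
  have h2 := (hasDerivAt_id t).mul (h1.rpow_const (p := p / 2 - 1) (Or.inl hy.ne'))
  refine HasDerivAt.congr_deriv h2 ?_
  have e : (t ^ 2 + ε) ^ (p / 2 - 1) = (t ^ 2 + ε) ^ (p / 2 - 2) * (t ^ 2 + ε) := by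
    conv_rhs => rw [← Real.rpow_add_one hy.ne']
    congr 1; ring
  have e2 : p / 2 - 1 - 1 = p / 2 - 2 := by ring
  rw [e2]
  simp only [id, e]
  ring

theorem relF_hasDerivAt {p ε : ℝ} (hp : 1 < p) (hε : 0 < ε) (t : ℝ) :
    HasDerivAt (relF p ε) (relf p ε t) t := by
  have hy : 0 < t ^ 2 + ε := by positivity
  have h1 : HasDerivAt (fun t : ℝ => t ^ 2 + ε) (2 * t) t := by
    simpa using (hasDerivAt_pow 2 t).add_const ε
  have h2 := ((h1.rpow_const (p := p / 2) (Or.inl hy.ne')).sub_const (ε ^ (p / 2))).div_const p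
  refine HasDerivAt.congr_deriv h2 ?_
  have : p ≠ 0 := by linarith
  unfold relf
  field_simp

theorem relf_contDiff {p ε : ℝ} (hε : 0 < ε) : ContDiff ℝ 1 (relf p ε) := by
  unfold relf
  refine contDiff_id.mul (ContDiff.rpow_const_of_ne (by fun_prop) fun t => ?_)
  positivity

theorem relF_contDiff {p ε : ℝ} (hε : 0 < ε) : ContDiff ℝ 1 (relF p ε) := by
  unfold relF
  refine ContDiff.div_const (ContDiff.sub (ContDiff.rpow_const_of_ne (by fun_prop) fun t => ?_) contDiff_const) _
  positivity

theorem relG_contDiff {p σ lam ε : ℝ} (hε : 0 < ε) : ContDiff ℝ 1 (relG p σ lam ε) := by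
  unfold relG
  have h1 := relf_contDiff (p := p) hε
  have h2 := relF_contDiff (p := p) hε
  fun_prop

theorem relG_deriv {p σ lam ε : ℝ} (hp : 1 < p) (hε : 0 < ε) (t : ℝ) :
    deriv (relG p σ lam ε) t = -σ * relf p ε t + 2 * lam * (t * deriv (relf p ε) t) := by
  have h1 := relf_hasDerivAt (p := p) hε t
  have h2 := relF_hasDerivAt hp hε t
  rw [h1.deriv]
  have h := ((h2.const_mul (-σ)).add ((((hasDerivAt_id t).mul h1).sub h2).const_mul (2 * lam))).deriv
  refine Eq.trans h ?_
  simp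

/-- t*f as power -/
theorem relf_mul {p ε : ℝ} (hε : 0 < ε) (t : ℝ) :
    t * relf p ε t = (t ^ 2 + ε) ^ (p / 2) - ε * (t ^ 2 + ε) ^ (p / 2 - 1) := by
  have hy : 0 < t ^ 2 + ε := by positivity
  have e : (t ^ 2 + ε) ^ (p / 2) = (t ^ 2 + ε) ^ (p / 2 - 1) * (t ^ 2 + ε) := by
    rw [← Real.rpow_add_one hy.ne']
    congr 1; ring
  rw [relf, e]; ring

theorem relF_nonneg {p ε : ℝ} (hp : 1 < p) (hε : 0 < ε) (t : ℝ) : 0 ≤ relF p ε t := by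
  unfold relF
  have : ε ^ (p / 2) ≤ (t ^ 2 + ε) ^ (p / 2) := by
    apply Real.rpow_le_rpow hε.le (by nlinarith [sq_nonneg t]) (by linarith)
  apply div_nonneg (by linarith) (by linarith)

theorem relF1_nonneg {p ε : ℝ} (hp : 1 < p) (hε : 0 < ε) (t : ℝ) :
    0 ≤ t * relf p ε t - relF p ε t := by
  have hy : 0 < t ^ 2 + ε := by positivity
  rw [relf_mul hε, relF]
  set y := t ^ 2 + ε with hyd
  have hεy : ε ≤ y := by rw [hyd]; nlinarith [sq_nonneg t]
  have hpq : p.HolderConjugate (p / (p - 1)) := Real.HolderConjugate.conjExponent hp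
  have hY := Real.young_inequality_of_nonneg (a := ε ^ (1 / 2 : ℝ)) (b := y ^ ((p - 1) / 2))
    (by positivity) (by positivity) hpq
  rw [← Real.rpow_mul hε.le, ← Real.rpow_mul hy.le] at hY
  have hp1 : p - 1 ≠ 0 := by linarith
  have hp0 : p ≠ 0 := by linarith
  have e1 : 1 / 2 * p = p / 2 := by ring
  have e2 : (p - 1) / 2 * (p / (p - 1)) = p / 2 := by field_simp
  rw [e1, e2] at hY
  have h3 : ε * y ^ (p / 2 - 1) ≤ ε ^ (1 / 2 : ℝ) * y ^ ((p - 1) / 2) := by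
    have a1 : ε = ε ^ (1/2:ℝ) * ε ^ (1/2:ℝ) := by
      rw [← Real.rpow_add hε]; norm_num
    have a2 : y ^ ((p - 1) / 2) = y ^ (1/2:ℝ) * y ^ (p / 2 - 1) := by
      rw [← Real.rpow_add hy]; congr 1; ring
    have a3 : ε ^ (1/2:ℝ) ≤ y ^ (1/2:ℝ) := Real.rpow_le_rpow hε.le hεy (by norm_num)
    rw [a2]
    conv_lhs => rw [a1]
    rw [mul_assoc]
    gcongr
  have e4 : y ^ (p / 2) / (p / (p - 1)) = y ^ (p / 2) - y ^ (p / 2) / p := by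
    field_simp
  rw [e4] at hY
  have e5 : (y ^ (p / 2) - ε ^ (p / 2)) / p = y ^ (p / 2) / p - ε ^ (p / 2) / p := by ring
  rw [e5]
  linarith

theorem relG_nonneg {p σ lam ε : ℝ} (hp : 1 < p) (hσ : σ ≤ 0) (hl : 0 ≤ lam) (hε : 0 < ε) (t : ℝ) :
    0 ≤ relG p σ lam ε t := by
  unfold relG
  have h1 := relF_nonneg hp hε t
  have h2 := relF1_nonneg hp hε t
  have : 0 ≤ -σ := by linarith
  positivity

theorem relf_bound {p ε M t : ℝ} (hp : 1 < p) (hε : 0 < ε) (hε1 : ε ≤ 1) (ht : |t| ≤ M) :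
    |relf p ε t| ≤ (M ^ 2 + 1) ^ ((p - 1) / 2) := by
  have hy : 0 < t ^ 2 + ε := by positivity
  have hyM : t ^ 2 + ε ≤ M ^ 2 + 1 := by
    have := sq_abs t
    nlinarith [abs_nonneg t]
  have h1 : |t| ≤ (t ^ 2 + ε) ^ (1/2:ℝ) := by
    rw [← Real.sqrt_eq_rpow]
    apply Real.abs_le_sqrt; linarith
  rw [relf, abs_mul, abs_of_nonneg (Real.rpow_nonneg hy.le _)]
  calc _ ≤ (t ^ 2 + ε) ^ (1/2:ℝ) * (t ^ 2 + ε) ^ (p / 2 - 1) := by gcongr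
    _ = (t ^ 2 + ε) ^ ((p - 1) / 2) := by rw [← Real.rpow_add hy]; congr 1; ring
    _ ≤ _ := Real.rpow_le_rpow hy.le hyM (by linarith)

theorem relG_bound {p σ lam ε M t : ℝ} (hp : 1 < p) (hσ : σ ≤ 0) (hl : 0 ≤ lam)
    (hε : 0 < ε) (hε1 : ε ≤ 1) (ht : |t| ≤ M) :
    |relG p σ lam ε t| ≤ (-σ + 2 * lam) * (M ^ 2 + 1) ^ (p / 2) := by
  have hy : 0 < t ^ 2 + ε := by positivity
  have hyM : t ^ 2 + ε ≤ M ^ 2 + 1 := by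
    have := sq_abs t
    nlinarith [abs_nonneg t]
  rw [abs_of_nonneg (relG_nonneg hp hσ hl hε t)]
  have h1 := relF_nonneg hp hε t
  have hpw : (t ^ 2 + ε) ^ (p / 2) ≤ (M ^ 2 + 1) ^ (p / 2) := Real.rpow_le_rpow hy.le hyM (by linarith)
  have h2 : relF p ε t ≤ (M ^ 2 + 1) ^ (p / 2) := by
    unfold relF
    have := Real.rpow_nonneg hε.le (p / 2)
    rw [div_le_iff₀ (by linarith)]
    nlinarith [Real.rpow_nonneg hy.le (p / 2)]
  have h3 : t * relf p ε t - relF p ε t ≤ (M ^ 2 + 1) ^ (p / 2) := by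
    rw [relf_mul hε]
    have : 0 ≤ ε * (t ^ 2 + ε) ^ (p / 2 - 1) := by positivity
    linarith
  unfold relG
  have : 0 ≤ -σ := by linarith
  rw [add_mul]
  gcongr

theorem relf'_bound {p ε M t : ℝ} (hp : 1 < p)
    (hε : 0 < ε) (hε1 : ε ≤ 1) (ht : |t| ≤ M) :
    |deriv (relf p ε) t * t ^ 2| ≤ p * (M ^ 2 + 1) ^ (p / 2) := by
  have hy : 0 < t ^ 2 + ε := by positivity
  have hyM : t ^ 2 + ε ≤ M ^ 2 + 1 := by
    have := sq_abs t
    nlinarith [abs_nonneg t]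
  have hpw : (t ^ 2 + ε) ^ (p / 2) ≤ (M ^ 2 + 1) ^ (p / 2) := Real.rpow_le_rpow hy.le hyM (by linarith)
  rw [(relf_hasDerivAt hε t).deriv]
  have hp1 : 0 < p - 1 := by linarith
  rw [abs_of_nonneg (by positivity)]
  have e : (t ^ 2 + ε) ^ (p / 2) = (t ^ 2 + ε) ^ (p / 2 - 2) * (t ^ 2 + ε) ^ 2 := by
    rw [← Real.rpow_natCast (t ^ 2 + ε) 2, ← Real.rpow_add hy]; congr 1; push_cast; ring
  have h1 : ((p - 1) * t ^ 2 + ε) * t ^ 2 ≤ p * (t ^ 2 + ε) ^ 2 := by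
    nlinarith [sq_nonneg t, mul_nonneg (sq_nonneg t) (sq_nonneg t), mul_nonneg (sq_nonneg t) hε.le, sq_nonneg ε]
  calc _ = (t ^ 2 + ε) ^ (p / 2 - 2) * (((p - 1) * t ^ 2 + ε) * t ^ 2) := by ring
    _ ≤ (t ^ 2 + ε) ^ (p / 2 - 2) * (p * (t ^ 2 + ε) ^ 2) := by gcongr
    _ = p * (t ^ 2 + ε) ^ (p / 2) := by rw [e]; ring
    _ ≤ _ := by gcongr

theorem relf_zero {p ε : ℝ} : relf p ε 0 = 0 := by simp [relf]
theorem relG_zero {p σ lam ε : ℝ} : relG p σ lam ε 0 = 0 := by simp [relG, relF]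

theorem rel_lim_rpow {t γ : ℝ} (ht : t ≠ 0) :
    Tendsto (fun n : ℕ => (t ^ 2 + 1 / ((n:ℝ) + 1)) ^ γ) atTop (nhds (|t| ^ (2 * γ))) := by
  have h1 : Tendsto (fun n : ℕ => t ^ 2 + 1 / ((n:ℝ) + 1)) atTop (nhds (t ^ 2 + 0)) :=
    tendsto_const_nhds.add tendsto_one_div_add_atTop_nhds_zero_nat
  rw [add_zero] at h1
  have h2 := h1.rpow_const (p := γ) (Or.inl (by positivity))
  convert h2 using 2
  rw [← sq_abs, ← Real.rpow_natCast, ← Real.rpow_mul (abs_nonneg t)]; norm_num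

theorem relf_lim {p t : ℝ} (hp : 1 < p) : 
    Tendsto (fun n : ℕ => relf p (1 / ((n:ℝ) + 1)) t) atTop (nhds (t * |t| ^ (p - 2))) := by
  by_cases ht : t = 0
  · subst ht; simp [relf_zero]
  unfold relf
  have := (rel_lim_rpow (γ := p / 2 - 1) ht).const_mul t
  convert this using 4; ring

theorem relf'_lim {p t : ℝ} (hp : 1 < p) : 
    Tendsto (fun n : ℕ => deriv (relf p (1 / ((n:ℝ) + 1))) t * t ^ 2) atTop (nhds ((p - 1) * |t| ^ p)) := by
  by_cases ht : t = 0
  · subst ht; simp [show p ≠ 0 by linarith]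
  have h0 : ∀ n : ℕ, deriv (relf p (1 / ((n:ℝ) + 1))) t * t ^ 2 =
    (t ^ 2 + (1 / ((n:ℝ) + 1))) ^ (p / 2 - 2) * ((p - 1) * t ^ 2 + (1 / ((n:ℝ) + 1))) * t ^ 2 := fun n => by
      rw [(relf_hasDerivAt (by positivity) t).deriv]
  simp_rw [h0]
  have h1 : Tendsto (fun n : ℕ => (p - 1) * t ^ 2 + 1 / ((n:ℝ) + 1)) atTop (nhds ((p - 1) * t ^ 2 + 0)) :=
    tendsto_const_nhds.add tendsto_one_div_add_atTop_nhds_zero_nat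
  have := ((rel_lim_rpow (γ := p / 2 - 2) ht).mul h1).mul_const (t ^ 2)
  convert this using 2
  have e : |t| ^ p = |t| ^ (2 * (p / 2 - 2)) * |t| ^ 4 := by
    rw [← Real.rpow_natCast |t| 4, ← Real.rpow_add (abs_pos.2 ht)]; congr 1; push_cast; ring
  rw [e, add_zero]
  have : |t| ^ 4 = t ^ 4 := by rw [show (4:ℕ) = 2 * 2 by norm_num, pow_mul, pow_mul, sq_abs]
  rw [this]; ring

theorem relG_lim {p σ lam t : ℝ} (hp : 1 < p) : 
    Tendsto (fun n : ℕ => relG p σ lam (1 / ((n:ℝ) + 1)) t) atTop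
      (nhds ((-σ / p + 2 * lam * ((p - 1) / p)) * |t| ^ p)) := by
  by_cases ht : t = 0
  · subst ht; simp [relG_zero, show p ≠ 0 by linarith]
  unfold relG relF
  have h1 := (rel_lim_rpow (γ := p / 2) ht)
  have h2 : Tendsto (fun n : ℕ => (1 / ((n:ℝ) + 1)) ^ (p / 2)) atTop (nhds (0 ^ (p / 2))) :=
    tendsto_one_div_add_atTop_nhds_zero_nat.rpow_const (Or.inr (by linarith))
  rw [Real.zero_rpow (by linarith)] at h2
  have h3 := (h1.sub h2).div_const p
  have h4 := (h3.const_mul (-σ)).add ((((relf_lim (t := t) hp).const_mul t).sub h3).const_mul (2 * lam))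
  convert h4 using 2
  have e : |t| ^ p = |t| ^ (p - 2) * t ^ 2 := by
    rw [← sq_abs, ← Real.rpow_natCast |t| 2, ← Real.rpow_add (abs_pos.2 ht)]; congr 1; push_cast; ring
  have e2 : 2 * (p / 2) = p := by ring
  rw [e2]
  have e3 : t * (t * |t| ^ (p - 2)) = |t| ^ p := by rw [e]; ring
  rw [e3]
  have : p ≠ 0 := by linarith
  field_simp
  ring


theorem rel_lapl_off {d : ℕ} {φ : EuclideanSpace ℝ (Fin d) → ℝ} {x : EuclideanSpace ℝ (Fin d)}
    (hx : x ∉ tsupport φ) : lapl φ x = 0 := by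
  unfold lapl
  have : iteratedFDeriv ℝ 2 φ x = 0 := by
    by_contra h
    exact hx (support_iteratedFDeriv_subset (𝕜 := ℝ) (f := φ) 2 h)
  simp [this]

theorem rel_Hop_off {d : ℕ} {K : Set (EuclideanSpace ℝ (Fin d))} {δ δ' : ℝ}
    {φ : EuclideanSpace ℝ (Fin d) → ℝ} {x : EuclideanSpace ℝ (Fin d)}
    (hx : x ∉ tsupport φ) : Hop K δ δ' φ x = 0 := by
  unfold Hop
  rw [rel_lapl_off hx, gradient, gradient, fderiv_of_notMem_tsupport ℝ hx]
  simp

theorem rel_infDist_pos {d : ℕ} {K : Set (EuclideanSpace ℝ (Fin d))}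
    (hKcl : IsClosed K) (hKne : K.Nonempty) {x : EuclideanSpace ℝ (Fin d)} (hx : x ∉ K) :
    0 < Metric.infDist x K := (hKcl.notMem_iff_infDist_pos hKne).1 hx

theorem rel_rpow_cont {d : ℕ} {K : Set (EuclideanSpace ℝ (Fin d))}
    (hKcl : IsClosed K) (hKne : K.Nonempty) (γ : ℝ) {x : EuclideanSpace ℝ (Fin d)} (hx : x ∉ K) :
    ContinuousAt (fun y => Metric.infDist y K ^ γ) x :=
  (Metric.continuous_infDist_pt K).continuousAt.rpow_const (Or.inl (rel_infDist_pos hKcl hKne hx).ne')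

theorem rel_Hop_cont {d : ℕ} (K : Set (EuclideanSpace ℝ (Fin d)))
    (hKcl : IsClosed K) (hKne : K.Nonempty)
    (P : EuclideanSpace ℝ (Fin d) → EuclideanSpace ℝ (Fin d)) (hP : ∀ x, P x ∈ K)
    (hd : ∀ x, Metric.infDist x K = ‖x - P x‖)
    (hL : LipschitzWith 1 P) (δ : ℝ) (φ : EuclideanSpace ℝ (Fin d) → ℝ)
    (hφ : ContDiff ℝ 2 φ) {x : EuclideanSpace ℝ (Fin d)} (hx : x ∉ K) :
    ContinuousAt (Hop K δ δ φ) x := by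
  have h1 : Hop K δ δ φ =ᶠ[nhds x] fun x => - Metric.infDist x K ^ δ * lapl φ x - δ*Metric.infDist x K ^(δ-2)*fderiv ℝ φ x (x - P x) := by
    filter_upwards [hKcl.isOpen_compl.mem_nhds hx] with y hy
    exact rel_Hop_eq K hKcl hKne P hP hd hL δ φ y hy
  refine ContinuousAt.congr ?_ h1.symm
  have h2 : Continuous (lapl φ) := by
    unfold lapl
    refine continuous_finsetSum _ fun i _ => ?_
    have := hφ.continuous_iteratedFDeriv (m := 2) le_rfl
    fun_prop
  have h3 : Continuous (fun x => fderiv ℝ φ x (x - P x)) := by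
    have := hφ.continuous_fderiv (by norm_num)
    have := hL.continuous
    fun_prop
  have h4 := rel_rpow_cont hKcl hKne δ hx
  have h5 := rel_rpow_cont hKcl hKne (δ-2) hx
  exact (h4.neg.mul h2.continuousAt).sub ((continuousAt_const.mul h5).mul h3.continuousAt)

theorem rel_limit {d : ℕ} (K : Set (EuclideanSpace ℝ (Fin d)))
    (hKcl : IsClosed K) (hKne : K.Nonempty)
    (P : EuclideanSpace ℝ (Fin d) → EuclideanSpace ℝ (Fin d)) (hP : ∀ x, P x ∈ K)
    (hd : ∀ x, Metric.infDist x K = ‖x - P x‖)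
    (hL : LipschitzWith 1 P) (p δ σ lam : ℝ) (hp : 1 < p) (hσ : σ ≤ 0) (hl : 0 ≤ lam)
    (φ : EuclideanSpace ℝ (Fin d) → ℝ)
    (hφ : ContDiff ℝ 2 φ) (hφc : HasCompactSupport φ) (hφK : tsupport φ ⊆ Kᶜ) (g : EuclideanSpace ℝ (Fin d) → ℝ)
    (hg : g = fun x => (Hop K δ δ φ x * Metric.infDist x K ^ σ * (φ x * |φ x| ^ (p - 2)) -
      Metric.infDist x K ^ (δ + σ - 2) * (((d : ℝ) - Module.finrank ℝ (affineSpan ℝ K).direction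
        + (δ + σ - 2)) * ((-σ / p + 2 * lam * ((p - 1) / p)) * |φ x| ^ p) - lam ^ 2 * ((p - 1) * |φ x| ^ p)))) :
    Integrable g ∧ 0 ≤ ∫ x, g x := by
  obtain ⟨M, hM⟩ : ∃ M, ∀ x, |φ x| ≤ M := by
    obtain ⟨M, hM⟩ := hφc.exists_bound_of_continuous hφ.continuous
    exact ⟨M, fun x => by simpa using hM x⟩
  set N := (d : ℝ) - Module.finrank ℝ (affineSpan ℝ K).direction + (δ + σ - 2) with hN
  let F : ℕ → EuclideanSpace ℝ (Fin d) → ℝ := fun n x => Hop K δ δ φ x * Metric.infDist x K ^ σ * relf p (1 / ((n:ℝ) + 1)) (φ x) -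
      Metric.infDist x K ^ (δ + σ - 2) * (N * relG p σ lam (1 / ((n:ℝ) + 1)) (φ x) - lam^2 * (deriv (relf p (1 / ((n:ℝ) + 1))) (φ x) * φ x ^ 2))
  have hε : ∀ n : ℕ, 0 < 1 / ((n:ℝ) + 1) := fun n => by positivity
  have hε1 : ∀ n : ℕ, 1 / ((n:ℝ) + 1) ≤ 1 := fun n => by
    rw [div_le_one (by positivity)]; linarith [Nat.cast_nonneg (α := ℝ) n]
  have hφ0 : ∀ x, x ∉ tsupport φ → φ x = 0 := fun x hx => image_eq_zero_of_notMem_tsupport hx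
  have hFc : ∀ n, Continuous (F n) := fun n => by
    refine (rel_continuous_off (K := K) hφc hφK (fun x hx => ?_) (fun x hx => ?_)).1
    · have h1 := rel_Hop_cont K hKcl hKne P hP hd hL δ φ hφ hx
      have h2 := rel_rpow_cont hKcl hKne σ hx
      have h3 := rel_rpow_cont hKcl hKne (δ+σ-2) hx
      have h4 : Continuous (relf p (1 / ((n:ℝ) + 1))) := (relf_contDiff (hε n)).continuous
      have h5 : Continuous (deriv (relf p (1 / ((n:ℝ) + 1)))) := (relf_contDiff (hε n)).continuous_deriv (by norm_num)
      have h6 : Continuous (relG p σ lam (1 / ((n:ℝ) + 1))) := (relG_contDiff (hε n)).continuous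
      have h7 := hφ.continuous
      have h8 : Continuous fun x => relf p (1 / ((n:ℝ) + 1)) (φ x) := by fun_prop
      have h9 : Continuous fun x => N * relG p σ lam (1 / ((n:ℝ) + 1)) (φ x) - lam^2 * (deriv (relf p (1 / ((n:ℝ) + 1))) (φ x) * φ x ^ 2) := by fun_prop
      exact ((h1.mul h2).mul h8.continuousAt).sub (h3.mul h9.continuousAt)
    · simp only [F, hφ0 x hx, relf_zero, relG_zero]; simp
  have h0 : ∀ n, 0 ≤ ∫ x, F n x := fun n => 
    rel_core K hKcl hKne P hP hd hL δ σ lam φ hφ hφc hφK _ _ (relf_contDiff (hε n)) (relG_contDiff (hε n))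
      relf_zero relG_zero (relG_nonneg hp hσ hl (hε n)) (fun t => by
        rw [(relf_hasDerivAt (hε n) t).deriv]
        have := hε n
        have : 0 ≤ p - 1 := by linarith
        positivity) (relG_deriv hp (hε n))
  set w : EuclideanSpace ℝ (Fin d) → ℝ := (tsupport φ).indicator fun x => Metric.infDist x K ^ (δ + σ - 2) with hw
  have hwi : Integrable w := by
    rw [hw, integrable_indicator_iff hφc.measurableSet]
    refine ContinuousOn.integrableOn_compact hφc fun x hx => ?_
    exact (rel_rpow_cont hKcl hKne (δ+σ-2) (hφK hx)).continuousWithinAt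
  have hhi : Integrable fun x => Hop K δ δ φ x * Metric.infDist x K ^ σ := by
    have := rel_continuous_off (K := K) (f := fun x => Hop K δ δ φ x * Metric.infDist x K ^ σ) hφc hφK (fun x hx => ?_) (fun x hx => ?_)
    · exact this.1.integrable_of_hasCompactSupport this.2
    · exact (rel_Hop_cont K hKcl hKne P hP hd hL δ φ hφ hx).mul (rel_rpow_cont hKcl hKne σ hx)
    · simp [rel_Hop_off hx]
  set C1 := (M ^ 2 + 1) ^ ((p - 1) / 2) with hC1
  set C2 := |N| * ((-σ + 2 * lam) * (M ^ 2 + 1) ^ (p / 2)) + lam^2 * (p * (M ^ 2 + 1) ^ (p / 2)) with hC2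
  have hbi : Integrable fun x => |Hop K δ δ φ x * Metric.infDist x K ^ σ| * C1 + |w x| * C2 :=
    (hhi.abs.mul_const _).add (hwi.abs.mul_const _)
  have hb : ∀ n x, ‖F n x‖ ≤ |Hop K δ δ φ x * Metric.infDist x K ^ σ| * C1 + |w x| * C2 := fun n x => by
    by_cases hx : x ∈ tsupport φ
    · have e : w x = Metric.infDist x K ^ (δ + σ - 2) := by rw [hw, indicator_of_mem hx]
      rw [e]
      simp only [F, Real.norm_eq_abs]
      refine (abs_sub _ _).trans ?_
      rw [abs_mul, abs_mul (Metric.infDist x K ^ (δ + σ - 2))]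
      have b1 := relf_bound hp (hε n) (hε1 n) (hM x)
      have b2 := relG_bound hp hσ hl (hε n) (hε1 n) (hM x)
      have b3 := relf'_bound hp (hε n) (hε1 n) (hM x)
      refine add_le_add (mul_le_mul_of_nonneg_left b1 (abs_nonneg _)) (mul_le_mul_of_nonneg_left ?_ (abs_nonneg _))
      refine (abs_sub _ _).trans ?_
      rw [abs_mul, abs_mul (lam ^ 2), abs_of_nonneg (sq_nonneg lam)]
      exact add_le_add (mul_le_mul_of_nonneg_left b2 (abs_nonneg _)) (mul_le_mul_of_nonneg_left b3 (sq_nonneg _))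
    · simp only [F, hφ0 x hx, relf_zero, relG_zero]
      have : w x = 0 := by rw [hw, indicator_of_notMem hx]
      simp [this]
      positivity
  have hlim : ∀ x, Tendsto (fun n => F n x) atTop (nhds (g x)) := fun x => by
    rw [hg]
    exact ((relf_lim hp).const_mul _).sub ((((relG_lim hp).const_mul _).sub ((relf'_lim hp).const_mul _)).const_mul _)
  refine ⟨?_, ?_⟩
  · refine hbi.mono' (aestronglyMeasurable_of_tendsto_ae atTop (fun n => (hFc n).aestronglyMeasurable) (.of_forall hlim)) (.of_forall fun x => ?_)
    exact le_of_tendsto (hlim x).norm (.of_forall fun n => hb n x)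
  · have := tendsto_integral_of_dominated_convergence _ (fun n => (hFc n).aestronglyMeasurable) hbi (fun n => .of_forall (hb n)) (.of_forall hlim)
    exact ge_of_tendsto this (.of_forall h0)

theorem rel_lower {d : ℕ} (K : Set (EuclideanSpace ℝ (Fin d)))
    (hKcl : IsClosed K) (hKne : K.Nonempty) (hKconv : Convex ℝ K) (p δ m C : ℝ) (hp : 1 < p) (hδ2 : δ < 2)
    (hm : m = (d : ℝ) - Module.finrank ℝ (affineSpan ℝ K).direction) (hm0 : 0 < m)
    (hN : 0 < m + p * δ - 2 * p) (hC : C = (p - 1) * m * (m + p * δ - 2 * p) / p ^ 2) 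
    (φ : EuclideanSpace ℝ (Fin d) → ℝ)
    (hφ : ContDiff ℝ 2 φ) (hφc : HasCompactSupport φ) (hφK : tsupport φ ⊆ Kᶜ) (hφ0 : φ ≠ 0) :
    C ^ p ≤ (∫ x in Kᶜ, |Hop K δ δ φ x| ^ p) /
        (∫ x in Kᶜ, (cWeight K δ δ x * Metric.infDist x K ^ (-(2 : ℝ))) ^ p * |φ x| ^ p) := by
  obtain ⟨P, hP, hd, -, hL⟩ := rel_proj_exists K hKne hKcl hKconv
  have hp0 : 0 < p := by linarith
  have hp1 : 0 < p - 1 := by linarith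
  have hC0 : 0 < C := by rw [hC]; positivity
  have hφz : ∀ x, x ∉ tsupport φ → φ x = 0 := fun x hx => image_eq_zero_of_notMem_tsupport hx
  have hKT : ∀ x, x ∉ Kᶜ → x ∉ tsupport φ := fun x hx h => hx (hφK h)
  rw [setIntegral_eq_integral_of_forall_compl_eq_zero (fun x hx => by
      rw [rel_Hop_off (hKT x hx)]; simp [hp0.ne']),
    setIntegral_eq_integral_of_forall_compl_eq_zero (fun x hx => by
      rw [hφz x (hKT x hx)]; simp [hp0.ne'])]
  have hw : ∀ x, (cWeight K δ δ x * Metric.infDist x K ^ (-(2 : ℝ))) ^ p * |φ x| ^ p = 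
      (Metric.infDist x K ^ (δ - 2) * |φ x|) ^ p := fun x => by
    by_cases hx : x ∈ K
    · rw [hφz x (fun h => hφK h hx)]; simp [hp0.ne']
    have h1 := rel_infDist_pos hKcl hKne hx
    rw [cWeight, sub_self, Real.rpow_zero, mul_one, ← Real.rpow_add h1, ← sub_eq_add_neg,
      Real.mul_rpow (by positivity) (by positivity)]
  simp_rw [hw]
  have hBc : Continuous (fun x => (Metric.infDist x K ^ (δ - 2) * |φ x|) ^ p) ∧ 
      HasCompactSupport (fun x => (Metric.infDist x K ^ (δ - 2) * |φ x|) ^ p) := by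
    refine rel_continuous_off (K := K) hφc hφK (fun x hx => ?_) (fun x hx => ?_)
    · exact ((rel_rpow_cont hKcl hKne (δ-2) hx).mul hφ.continuous.continuousAt.abs).rpow_const (Or.inr hp0.le)
    · rw [hφz x hx]; simp [hp0.ne']
  have hAc : Continuous (fun x => |Hop K δ δ φ x| ^ p) ∧ 
      HasCompactSupport (fun x => |Hop K δ δ φ x| ^ p) := by
    refine rel_continuous_off (K := K) hφc hφK (fun x hx => ?_) (fun x hx => ?_)
    · exact (rel_Hop_cont K hKcl hKne P hP hd hL δ φ hφ hx).abs.rpow_const (Or.inr hp0.le)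
    · rw [rel_Hop_off hx]; simp [hp0.ne']
  have hBi := hBc.1.integrable_of_hasCompactSupport (μ := volume) hBc.2
  have hAi := hAc.1.integrable_of_hasCompactSupport (μ := volume) hAc.2
  have hBpos : 0 < ∫ x, (Metric.infDist x K ^ (δ - 2) * |φ x|) ^ p := by
    obtain ⟨x, hx⟩ := Function.ne_iff.1 hφ0
    refine hBc.1.integral_pos_of_hasCompactSupport_nonneg_nonzero hBc.2 (fun x => ?_) (x := x) ?_
    · have := Metric.infDist_nonneg (x := x) (s := K)
      show 0 ≤ (Metric.infDist x K ^ (δ - 2) * |φ x|) ^ p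
      positivity
    · have hxK : x ∉ K := fun h => hφK (subset_tsupport _ hx) h
      have h1 := rel_infDist_pos hKcl hKne hxK
      have : 0 < |φ x| := abs_pos.2 hx
      show (Metric.infDist x K ^ (δ - 2) * |φ x|) ^ p ≠ 0
      positivity
  rw [le_div_iff₀ hBpos]
  set σ := (δ - 2) * (p - 1) with hσ
  obtain ⟨hgi, hg0⟩ := rel_limit K hKcl hKne P hP hd hL p δ σ ((m + p * δ - 2 * p) / p) hp (by
    rw [hσ]; nlinarith) (by positivity) φ hφ hφc hφK _ rfl
  have key : ∀ x, C ^ (p - 1) * (Hop K δ δ φ x * Metric.infDist x K ^ σ * (φ x * |φ x| ^ (p - 2)) -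
      Metric.infDist x K ^ (δ + σ - 2) * (((d : ℝ) - Module.finrank ℝ (affineSpan ℝ K).direction
        + (δ + σ - 2)) * ((-σ / p + 2 * ((m + p * δ - 2 * p) / p) * ((p - 1) / p)) * |φ x| ^ p) - ((m + p * δ - 2 * p) / p) ^ 2 * ((p - 1) * |φ x| ^ p)))
      ≤ p⁻¹ * |Hop K δ δ φ x| ^ p - p⁻¹ * C ^ p * (Metric.infDist x K ^ (δ - 2) * |φ x|) ^ p := fun x => by
    by_cases hx : φ x = 0
    · rw [hx]; simp [hp0.ne']; positivity
    have hxK : x ∉ K := fun h => hφK (subset_tsupport _ hx) h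
    have hr := rel_infDist_pos hKcl hKne hxK
    set r := Metric.infDist x K
    have hφp : 0 < |φ x| := abs_pos.2 hx
    set b := r ^ (δ - 2) * |φ x| with hb
    have hbp : 0 < b := by positivity
    have e1 : r ^ (δ + σ - 2) * |φ x| ^ p = b ^ p := by
      rw [hb, Real.mul_rpow (by positivity) (by positivity), ← Real.rpow_mul hr.le]
      congr 2; rw [hσ]; ring
    have e2 : r ^ (δ + σ - 2) * (((d : ℝ) - Module.finrank ℝ (affineSpan ℝ K).direction
        + (δ + σ - 2)) * ((-σ / p + 2 * ((m + p * δ - 2 * p) / p) * ((p - 1) / p)) * |φ x| ^ p) - ((m + p * δ - 2 * p) / p) ^ 2 * ((p - 1) * |φ x| ^ p)) = C * b ^ p := by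
      rw [← e1, ← hm, hC, hσ]; field_simp; ring
    have e3 : Hop K δ δ φ x * r ^ σ * (φ x * |φ x| ^ (p - 2)) ≤ |Hop K δ δ φ x| * b ^ (p - 1) := by
      have : b ^ (p - 1) = r ^ σ * (|φ x| * |φ x| ^ (p - 2)) := by
        rw [hb, Real.mul_rpow (by positivity) (by positivity), ← Real.rpow_mul hr.le, ← Real.rpow_one_add' hφp.le (by linarith)]
        congr 2; ring
      rw [this]
      refine (le_abs_self _).trans (le_of_eq ?_)
      rw [abs_mul, abs_mul, abs_mul, abs_of_nonneg (by positivity : 0 ≤ r ^ σ), abs_of_nonneg (by positivity : 0 ≤ |φ x| ^ (p-2))]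
      ring
    have hpq : p.HolderConjugate (p / (p - 1)) := Real.HolderConjugate.conjExponent hp
    have yng := Real.young_inequality_of_nonneg (abs_nonneg (Hop K δ δ φ x)) (by positivity : 0 ≤ (C * b) ^ (p - 1)) hpq
    rw [← Real.rpow_mul (by positivity), mul_div_cancel₀ _ hp1.ne'] at yng
    have e4 : C ^ (p - 1) * C = C ^ p := by
      rw [← Real.rpow_add_one hC0.ne']; congr 1; ring
    rw [Real.mul_rpow hC0.le hbp.le, Real.mul_rpow hC0.le hbp.le] at yng
    rw [e2, mul_sub]
    have h6 := mul_le_mul_of_nonneg_left e3 (by positivity : 0 ≤ C ^ (p - 1))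
    have h7 : C ^ p * b ^ p / (p / (p - 1)) = C ^ p * b ^ p - p⁻¹ * C ^ p * b ^ p := by
      field_simp
    have h8 : C ^ (p-1) * (C * b ^ p) = C ^ p * b ^ p := by rw [← mul_assoc, e4]
    rw [h8]
    rw [h7, div_eq_inv_mul] at yng
    nlinarith [yng]
  have := integral_mono (hgi.const_mul (C ^ (p-1))) ((hAi.const_mul p⁻¹).sub (hBi.const_mul (p⁻¹ * C ^ p))) key
  rw [integral_const_mul] at this
  simp only [Pi.sub_apply] at this
  rw [integral_sub (hAi.const_mul _) (hBi.const_mul _), integral_const_mul, integral_const_mul] at this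
  have h9 := (mul_nonneg (by positivity : 0 ≤ C ^ (p - 1)) hg0).trans this
  have h10 : 0 ≤ p⁻¹ * ((∫ x, |Hop K δ δ φ x| ^ p) - C ^ p * ∫ x, (Metric.infDist x K ^ (δ - 2) * |φ x|) ^ p) := by linarith
  have := (mul_nonneg_iff_of_pos_left (inv_pos.2 hp0)).1 h10
  linarith


theorem rel_prod_integral {d : ℕ} (W : Submodule ℝ (EuclideanSpace ℝ (Fin d)))
    (a : EuclideanSpace ℝ (Fin d)) (f g : EuclideanSpace ℝ (Fin d) → ℝ) :
    ∫ x, f (W.starProjection (x - a)) * g (Wᗮ.starProjection (x - a)) =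
      (∫ w : W, f w) * ∫ v : Wᗮ, g v := by
  rw [integral_sub_right_eq_self (fun x => f (W.starProjection x) * g (Wᗮ.starProjection x)) a]
  have h1 : MeasurePreserving (fun x => (W.orthogonalDecomposition x).ofLp) volume volume :=
    (WithLp.volume_preserving_ofLp W Wᗮ).comp W.orthogonalDecomposition.measurePreserving
  have he : MeasurableEmbedding (fun x => (W.orthogonalDecomposition x).ofLp) :=
    (MeasurableEquiv.toLp 2 (W × Wᗮ)).symm.measurableEmbedding.comp
      W.orthogonalDecomposition.toMeasurableEquiv.measurableEmbedding
  have h2 := h1.integral_comp he (fun z : W × Wᗮ => f z.1 * g z.2)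
  rw [← integral_prod_mul (fun w : W => f w) (fun v : Wᗮ => g v)]
  refine Eq.trans ?_ h2
  refine integral_congr_ae (.of_forall fun x => ?_)
  simp

theorem rel_trace {d : ℕ} (W : Submodule ℝ (EuclideanSpace ℝ (Fin d))) :
    ∑ i, ⟪W.starProjection (EuclideanSpace.single i 1), EuclideanSpace.single i (1:ℝ)⟫ = 
      Module.finrank ℝ W := by
  have h1 := LinearMap.trace_eq_sum_inner (W.starProjection : EuclideanSpace ℝ (Fin d) →ₗ[ℝ] EuclideanSpace ℝ (Fin d)) (EuclideanSpace.basisFun (Fin d) ℝ)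
  have h2 : LinearMap.IsProj W (W.starProjection : EuclideanSpace ℝ (Fin d) →ₗ[ℝ] EuclideanSpace ℝ (Fin d)) := 
    ⟨fun x => by simp, fun x hx => by simpa using W.starProjection_eq_self_iff.2 hx⟩
  rw [h2.trace] at h1
  rw [h1]
  refine Finset.sum_congr rfl fun i _ => ?_
  simp [real_inner_comm]

theorem rel_sum_inner {d : ℕ} (x y : EuclideanSpace ℝ (Fin d)) :
    ∑ i, ⟪x, EuclideanSpace.single i (1:ℝ)⟫ * ⟪y, EuclideanSpace.single i (1:ℝ)⟫ = ⟪x, y⟫ := by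
  rw [← (EuclideanSpace.basisFun (Fin d) ℝ).sum_inner_mul_inner x y]
  refine Finset.sum_congr rfl fun i _ => ?_
  rw [real_inner_comm y]
  simp

theorem rel_normsq_deriv {d : ℕ} (W : Submodule ℝ (EuclideanSpace ℝ (Fin d)))
    (a x : EuclideanSpace ℝ (Fin d)) :
    HasFDerivAt (fun y => ‖W.starProjection (y - a)‖ ^ 2) ((2:ℝ) • innerSL ℝ (W.starProjection (x - a))) x := by
  have h := (W.starProjection.hasFDerivAt.comp x ((hasFDerivAt_id x).sub_const a)).norm_sq
  refine HasFDerivAt.congr_fderiv h ?_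
  ext v
  have : ⟪W.starProjection (x - a), W.starProjection v⟫ = ⟪W.starProjection (x - a), v⟫ := by
    rw [W.inner_starProjection_left_eq_right, W.inner_starProjection_left_eq_right, 
      W.starProjection_eq_self_iff.2 (W.starProjection_apply_mem v)]
  simp only [smul_apply, ContinuousLinearMap.comp_apply, innerSL_apply_apply, id]
  simpa using this

theorem rel_test_fderiv {d : ℕ} (W : Submodule ℝ (EuclideanSpace ℝ (Fin d)))
    (a : EuclideanSpace ℝ (Fin d)) (F1 F2 : ℝ → ℝ) (h1 : ContDiff ℝ 2 F1) (h2 : ContDiff ℝ 2 F2)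
    (x v : EuclideanSpace ℝ (Fin d)) :
    fderiv ℝ (fun x => F1 (‖W.starProjection (x - a)‖ ^ 2) * F2 (‖Wᗮ.starProjection (x - a)‖ ^ 2)) x v =
      deriv F1 (‖W.starProjection (x - a)‖ ^ 2) * F2 (‖Wᗮ.starProjection (x - a)‖ ^ 2) * 
        (2 * ⟪W.starProjection (x - a), v⟫) + 
      F1 (‖W.starProjection (x - a)‖ ^ 2) * deriv F2 (‖Wᗮ.starProjection (x - a)‖ ^ 2) * 
        (2 * ⟪Wᗮ.starProjection (x - a), v⟫) := by
  have e1 := ((h1.differentiable (by norm_num)).differentiableAt.hasDerivAt (x := ‖W.starProjection (x - a)‖ ^ 2)).comp_hasFDerivAt x (rel_normsq_deriv W a x)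
  have e2 := ((h2.differentiable (by norm_num)).differentiableAt.hasDerivAt (x := ‖Wᗮ.starProjection (x - a)‖ ^ 2)).comp_hasFDerivAt x (rel_normsq_deriv Wᗮ a x)
  refine (congrArg (fun T => T v) (e1.mul e2).fderiv).trans ?_
  simp only [add_apply, smul_apply, innerSL_apply_apply, smul_eq_mul, Function.comp_apply]
  ring

theorem rel_test_lapl {d : ℕ} (W : Submodule ℝ (EuclideanSpace ℝ (Fin d)))
    (a : EuclideanSpace ℝ (Fin d)) (F1 F2 : ℝ → ℝ) (h1 : ContDiff ℝ 2 F1) (h2 : ContDiff ℝ 2 F2)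
    (x : EuclideanSpace ℝ (Fin d)) (Q q : ℝ) (hQ : Q = ‖W.starProjection (x - a)‖ ^ 2) (hq : q = ‖Wᗮ.starProjection (x - a)‖ ^ 2) :
    lapl (fun x => F1 (‖W.starProjection (x - a)‖ ^ 2) * F2 (‖Wᗮ.starProjection (x - a)‖ ^ 2)) x =
      (4 * Q * deriv (deriv F1) Q + 2 * Module.finrank ℝ W * deriv F1 Q) * F2 q +
      F1 Q * (4 * q * deriv (deriv F2) q + 2 * Module.finrank ℝ Wᗮ * deriv F2 q) := by
  have hcd : ContDiff ℝ 2 (fun x => F1 (‖W.starProjection (x - a)‖ ^ 2) * F2 (‖Wᗮ.starProjection (x - a)‖ ^ 2)) := by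
    have c1 : ContDiff ℝ 2 fun x => ‖W.starProjection (x - a)‖ ^ 2 := 
      (W.starProjection.contDiff.comp (contDiff_id.sub contDiff_const)).norm_sq ℝ
    have c2 : ContDiff ℝ 2 fun x => ‖Wᗮ.starProjection (x - a)‖ ^ 2 := 
      (Wᗮ.starProjection.contDiff.comp (contDiff_id.sub contDiff_const)).norm_sq ℝ
    exact (h1.comp c1).mul (h2.comp c2)
  rw [rel_lapl_eq _ hcd]
  simp_rw [rel_test_fderiv W a F1 F2 h1 h2]
  have d1 : ContDiff ℝ 1 (deriv F1) := h1.deriv' 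
  have d2 : ContDiff ℝ 1 (deriv F2) := h2.deriv' 
  have e1 := ((h1.differentiable (by norm_num)).differentiableAt.hasDerivAt (x := ‖W.starProjection (x - a)‖ ^ 2)).comp_hasFDerivAt x (rel_normsq_deriv W a x)
  have e2 := ((h2.differentiable (by norm_num)).differentiableAt.hasDerivAt (x := ‖Wᗮ.starProjection (x - a)‖ ^ 2)).comp_hasFDerivAt x (rel_normsq_deriv Wᗮ a x)
  have e1' := ((d1.differentiable (by norm_num)).differentiableAt.hasDerivAt (x := ‖W.starProjection (x - a)‖ ^ 2)).comp_hasFDerivAt x (rel_normsq_deriv W a x)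
  have e2' := ((d2.differentiable (by norm_num)).differentiableAt.hasDerivAt (x := ‖Wᗮ.starProjection (x - a)‖ ^ 2)).comp_hasFDerivAt x (rel_normsq_deriv Wᗮ a x)
  have hl : ∀ (V : Submodule ℝ (EuclideanSpace ℝ (Fin d))) (v : EuclideanSpace ℝ (Fin d)), HasFDerivAt (fun y => 2 * ⟪V.starProjection (y - a), v⟫)
      ((2:ℝ) • innerSL ℝ (V.starProjection v)) x := fun V v => by
    have := ((V.starProjection.hasFDerivAt.comp x ((hasFDerivAt_id x).sub_const a)).inner ℝ (hasFDerivAt_const v x)).const_mul (2:ℝ)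
    refine HasFDerivAt.congr_fderiv this ?_
    ext u
    simp [real_inner_comm]
    rw [← V.inner_starProjection_left_eq_right, real_inner_comm]
  have key : ∀ v, fderiv ℝ (fun x => deriv F1 (‖W.starProjection (x - a)‖ ^ 2) * F2 (‖Wᗮ.starProjection (x - a)‖ ^ 2) * 
        (2 * ⟪W.starProjection (x - a), v⟫) + 
      F1 (‖W.starProjection (x - a)‖ ^ 2) * deriv F2 (‖Wᗮ.starProjection (x - a)‖ ^ 2) * 
        (2 * ⟪Wᗮ.starProjection (x - a), v⟫)) x v = 
      4 * deriv (deriv F1) Q * F2 q * (⟪W.starProjection (x - a), v⟫ * ⟪W.starProjection (x - a), v⟫) +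
      8 * deriv F1 Q * deriv F2 q * (⟪W.starProjection (x - a), v⟫ * ⟪Wᗮ.starProjection (x - a), v⟫) +
      4 * F1 Q * deriv (deriv F2) q * (⟪Wᗮ.starProjection (x - a), v⟫ * ⟪Wᗮ.starProjection (x - a), v⟫) +
      2 * deriv F1 Q * F2 q * ⟪W.starProjection v, v⟫ + 2 * F1 Q * deriv F2 q * ⟪Wᗮ.starProjection v, v⟫ := fun v => by
    have := (((e1'.mul e2).mul (hl W v)).add ((e1.mul e2').mul (hl Wᗮ v))).fderiv
    refine (congrArg (fun T => T v) this).trans ?_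
    simp only [add_apply, smul_apply, innerSL_apply_apply, smul_eq_mul, Function.comp_apply, Pi.mul_apply, hQ, hq]
    ring
  simp_rw [key]
  simp only [Finset.sum_add_distrib, ← Finset.mul_sum]
  rw [rel_sum_inner, rel_sum_inner, rel_sum_inner, rel_trace, rel_trace]
  have o : ⟪W.starProjection (x - a), Wᗮ.starProjection (x - a)⟫ = 0 :=
    Submodule.inner_right_of_mem_orthogonal (Submodule.starProjection_apply_mem _ _) (Submodule.starProjection_apply_mem _ _)
  rw [o, real_inner_self_eq_norm_sq, real_inner_self_eq_norm_sq, ← hQ, ← hq]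
  ring


open Classical in
def relAnn {V : Type*} [NormedAddCommGroup V] (m : ℕ) (s t : ℝ) (v : V) : ℝ :=
  if s ≤ ‖v‖ ^ 2 ∧ ‖v‖ ^ 2 ≤ t then ‖v‖ ^ (-(m:ℝ)) else 0

open Classical in
def relBall {V : Type*} [NormedAddCommGroup V] (r : ℝ) (v : V) : ℝ :=
  if ‖v‖ ≤ r then 1 else 0

theorem relAnn_nonneg {V : Type*} [NormedAddCommGroup V] (m : ℕ) (s t : ℝ) (v : V) :
    0 ≤ relAnn m s t v := by
  unfold relAnn; split_ifs <;> positivity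

theorem relBall_nonneg {V : Type*} [NormedAddCommGroup V] (r : ℝ) (v : V) :
    0 ≤ relBall r v := by
  unfold relBall; split_ifs <;> positivity

theorem relAnn_integrable {V : Type*} [NormedAddCommGroup V] [InnerProductSpace ℝ V] [FiniteDimensional ℝ V]
    [MeasurableSpace V] [BorelSpace V] (m : ℕ) (s t : ℝ) (hs : 0 < s) :
    Integrable (relAnn m s t : V → ℝ) := by
  have hcl : IsClosed {v : V | s ≤ ‖v‖ ^ 2 ∧ ‖v‖ ^ 2 ≤ t} := by
    rw [ofPred_and]
    exact (isClosed_le continuous_const (by fun_prop)).inter (isClosed_le (by fun_prop) continuous_const)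
  have hcp : IsCompact {v : V | s ≤ ‖v‖ ^ 2 ∧ ‖v‖ ^ 2 ≤ t} := by
    refine (isCompact_closedBall (0:V) (Real.sqrt t)).of_isClosed_subset hcl fun v hv => ?_
    simp only [mem_closedBall_zero_iff]
    exact Real.le_sqrt_of_sq_le hv.2
  have : (relAnn m s t : V → ℝ) = {v : V | s ≤ ‖v‖ ^ 2 ∧ ‖v‖ ^ 2 ≤ t}.indicator (fun v => ‖v‖ ^ (-(m:ℝ))) := by
    classical
    ext v
    simp only [relAnn, indicator, mem_ofPred_eq]
  rw [this, integrable_indicator_iff hcl.measurableSet]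
  refine ContinuousOn.integrableOn_compact hcp fun v hv => ?_
  refine (continuous_norm.continuousAt.rpow_const (Or.inl ?_)).continuousWithinAt
  intro h
  have := hv.1
  rw [h] at this
  norm_num at this; linarith

theorem relAnn_scale {V : Type*} [NormedAddCommGroup V] [InnerProductSpace ℝ V] [FiniteDimensional ℝ V]
    [MeasurableSpace V] [BorelSpace V] (m : ℕ) (hm : Module.finrank ℝ V = m) (s t R : ℝ) (hR : 0 < R) :
    ∫ v : V, relAnn m (R ^ 2 * s) (R ^ 2 * t) v = ∫ v : V, relAnn m s t v := by
  have h1 := Measure.integral_comp_smul (volume : Measure V) (fun v => relAnn m (R ^ 2 * s) (R ^ 2 * t) v) R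
  have h2 : ∀ v : V, relAnn m (R ^ 2 * s) (R ^ 2 * t) (R • v) = (R ^ m)⁻¹ * relAnn m s t v := fun v => by
    unfold relAnn
    rw [norm_smul, Real.norm_of_nonneg hR.le, mul_pow]
    have hR2 : 0 < R ^ 2 := by positivity
    simp only [mul_le_mul_iff_right₀ hR2]
    split_ifs
    · rw [Real.mul_rpow hR.le (norm_nonneg _), Real.rpow_neg hR.le, Real.rpow_natCast]
    · simp
  simp_rw [h2] at h1
  rw [integral_const_mul, hm, abs_of_pos (by positivity), smul_eq_mul] at h1
  have : (R ^ m)⁻¹ ≠ 0 := by positivity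
  exact (mul_left_cancel₀ this h1).symm

theorem relBall_scale {V : Type*} [NormedAddCommGroup V] [InnerProductSpace ℝ V] [FiniteDimensional ℝ V]
    [MeasurableSpace V] [BorelSpace V] (r : ℝ) :
    ∫ v : V, relBall (2 * r) v = 2 ^ (Module.finrank ℝ V) * ∫ v : V, relBall r v := by
  have h1 := Measure.integral_comp_smul (volume : Measure V) (fun v => relBall r v) (2⁻¹:ℝ)
  have h2 : ∀ v : V, relBall r ((2⁻¹:ℝ) • v) = relBall (2 * r) v := fun v => by
    unfold relBall
    rw [norm_smul]
    have : ‖(2⁻¹:ℝ)‖ * ‖v‖ ≤ r ↔ ‖v‖ ≤ 2 * r := by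
      norm_num; constructor <;> intro h <;> linarith
    simp only [this]
  simp_rw [h2] at h1
  rw [h1, abs_of_pos (by positivity), smul_eq_mul, inv_pow, inv_inv]

theorem rel_meas_compare {d : ℕ} (W : Submodule ℝ (EuclideanSpace ℝ (Fin d)))
    (a : EuclideanSpace ℝ (Fin d)) (m : ℕ) (hm : Module.finrank ℝ Wᗮ = m) (ρ κ L : ℝ) :
    ∫ x, relBall (2 * ρ) (W.starProjection (x - a)) * 
        relAnn m (Real.exp ((L - 2) / κ)) (Real.exp ((L + 2) / κ)) (Wᗮ.starProjection (x - a)) ≤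
      2 * 2 ^ (Module.finrank ℝ W) * ∫ x, relBall ρ (W.starProjection (x - a)) * 
        relAnn m (Real.exp ((L - 1) / κ)) (Real.exp ((L + 1) / κ)) (Wᗮ.starProjection (x - a)) := by
  rw [rel_prod_integral W a (relBall (2 * ρ)) (relAnn m (Real.exp ((L - 2) / κ)) (Real.exp ((L + 2) / κ))),
    rel_prod_integral W a (relBall ρ) (relAnn m (Real.exp ((L - 1) / κ)) (Real.exp ((L + 1) / κ)))]
  have e1 : ∀ r, ∀ w : W, relBall r (w : EuclideanSpace ℝ (Fin d)) = relBall r w := fun r w => rfl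
  have e2 : ∀ s t, ∀ w : Wᗮ, relAnn m s t (w : EuclideanSpace ℝ (Fin d)) = relAnn m s t w := fun r s w => rfl
  simp_rw [e1, e2]
  rw [relBall_scale]
  have i1 : ∫ v : Wᗮ, relAnn m (Real.exp ((L - 2) / κ)) (Real.exp (L / κ)) v = ∫ v : Wᗮ, relAnn m (Real.exp ((L - 1) / κ)) (Real.exp ((L + 1) / κ)) v := by
    rw [← relAnn_scale m hm (Real.exp ((L - 2) / κ)) (Real.exp (L / κ)) (Real.exp (1 / (2 * κ))) (Real.exp_pos _)]
    rw [← Real.exp_nat_mul, ← Real.exp_add, ← Real.exp_add]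
    congr! 3 <;> congr 1 <;> push_cast <;> field_simp <;> ring
  have i2 : ∫ v : Wᗮ, relAnn m (Real.exp (L / κ)) (Real.exp ((L + 2) / κ)) v = ∫ v : Wᗮ, relAnn m (Real.exp ((L - 1) / κ)) (Real.exp ((L + 1) / κ)) v := by
    rw [← relAnn_scale m hm (Real.exp ((L - 1) / κ)) (Real.exp ((L+1) / κ)) (Real.exp (1 / (2 * κ))) (Real.exp_pos _)]
    rw [← Real.exp_nat_mul, ← Real.exp_add, ← Real.exp_add]
    congr! 3 <;> congr 1 <;> push_cast <;> field_simp <;> ring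
  have i3 : ∫ v : Wᗮ, relAnn m (Real.exp ((L - 2) / κ)) (Real.exp ((L + 2) / κ)) v ≤ 
      2 * ∫ v : Wᗮ, relAnn m (Real.exp ((L - 1) / κ)) (Real.exp ((L + 1) / κ)) v := by
    calc _ ≤ ∫ v : Wᗮ, (relAnn m (Real.exp ((L - 2) / κ)) (Real.exp (L / κ)) v + relAnn m (Real.exp (L / κ)) (Real.exp ((L + 2) / κ)) v) := by
          refine integral_mono (relAnn_integrable _ _ _ (Real.exp_pos _)) ((relAnn_integrable _ _ _ (Real.exp_pos _)).add (relAnn_integrable _ _ _ (Real.exp_pos _))) fun v => ?_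
          by_cases hv : Real.exp ((L - 2) / κ) ≤ ‖v‖ ^ 2 ∧ ‖v‖ ^ 2 ≤ Real.exp ((L + 2) / κ)
          · rcases le_total (‖v‖ ^ 2) (Real.exp (L / κ)) with h | h
            · have := relAnn_nonneg m (Real.exp (L / κ)) (Real.exp ((L + 2) / κ)) v
              have h3 : relAnn m (Real.exp ((L - 2) / κ)) (Real.exp ((L + 2) / κ)) v = relAnn m (Real.exp ((L - 2) / κ)) (Real.exp (L / κ)) v := by
                unfold relAnn; rw [if_pos hv, if_pos ⟨hv.1, h⟩]
              rw [h3]; linarith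
            · have := relAnn_nonneg m (Real.exp ((L - 2) / κ)) (Real.exp (L / κ)) v
              have h3 : relAnn m (Real.exp ((L - 2) / κ)) (Real.exp ((L + 2) / κ)) v = relAnn m (Real.exp (L / κ)) (Real.exp ((L + 2) / κ)) v := by
                unfold relAnn; rw [if_pos hv, if_pos ⟨h, hv.2⟩]
              rw [h3]; linarith
          · have h3 : relAnn m (Real.exp ((L - 2) / κ)) (Real.exp ((L + 2) / κ)) v = 0 := by unfold relAnn; rw [if_neg hv]
            rw [h3]
            exact add_nonneg (relAnn_nonneg _ _ _ _) (relAnn_nonneg _ _ _ _)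
      _ = _ := by
          rw [integral_add (relAnn_integrable _ _ _ (Real.exp_pos _)) (relAnn_integrable _ _ _ (Real.exp_pos _)), i1, i2]; ring
  have i4 : 0 ≤ ∫ v : W, relBall ρ v := integral_nonneg fun v => relBall_nonneg _ _
  calc _ ≤ 2 ^ (Module.finrank ℝ W) * (∫ v : W, relBall ρ v) * (2 * ∫ v : Wᗮ, relAnn m (Real.exp ((L - 1) / κ)) (Real.exp ((L + 1) / κ)) v) := by gcongr
    _ = _ := by ring

theorem rel_bump : ∃ (β : ℝ → ℝ) (M : ℝ), ContDiff ℝ 2 β ∧ (∀ u, 0 ≤ β u) ∧ (∀ u, β u ≤ 1) ∧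
    (∀ u, |u| ≤ 1 → β u = 1) ∧ (∀ u, 2 ≤ |u| → β u = 0) ∧ 0 ≤ M ∧ (∀ u, |deriv β u| ≤ M) ∧ 
    (∀ u, |deriv (deriv β) u| ≤ M) := by
  let f : ContDiffBump (0:ℝ) := ⟨1, 2, by norm_num, by norm_num⟩
  have hf : ContDiff ℝ 2 f := f.contDiff
  have h1 : ContDiff ℝ 1 (deriv f) := hf.deriv'
  obtain ⟨M1, hM1⟩ := f.hasCompactSupport.deriv.exists_bound_of_continuous h1.continuous
  obtain ⟨M2, hM2⟩ := f.hasCompactSupport.deriv.deriv.exists_bound_of_continuous (h1.continuous_deriv (by norm_num))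
  refine ⟨f, max M1 M2, hf, fun u => f.nonneg, fun u => f.le_one, fun u hu => f.one_of_mem_closedBall ?_, fun u hu => f.zero_of_le_dist ?_, ?_, fun u => ?_, fun u => ?_⟩
  · simpa using hu
  · simpa using hu
  · exact ((norm_nonneg _).trans (hM1 0)).trans (le_max_left _ _)
  · exact (hM1 u).trans (le_max_left _ _)
  · exact (hM2 u).trans (le_max_right _ _)

open Classical in
def relF2 (α κ L : ℝ) (β : ℝ → ℝ) (t : ℝ) : ℝ :=
  if 0 < t then Real.exp (-(α / 2) * Real.log t) * β (κ * Real.log t - L) else 0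

theorem relF2_zero {α κ L : ℝ} {β : ℝ → ℝ} (hκ : 0 < κ) (hβ : ∀ u, 2 ≤ |u| → β u = 0) {t : ℝ} 
    (ht : t ≤ Real.exp ((L - 2) / κ) ∨ Real.exp ((L + 2) / κ) ≤ t) : relF2 α κ L β t = 0 := by
  unfold relF2
  split_ifs with h
  · rw [hβ, mul_zero]
    rcases ht with ht | ht
    · rw [← Real.log_le_iff_le_exp h, le_div_iff₀ hκ] at ht
      rw [le_abs]; right; linarith
    · rw [← Real.le_log_iff_exp_le h, div_le_iff₀ hκ] at ht
      rw [le_abs]; left; linarith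
  · rfl

theorem relF2_contDiff {α κ L : ℝ} {β : ℝ → ℝ} (hκ : 0 < κ) (hb : ContDiff ℝ 2 β) (hβ : ∀ u, 2 ≤ |u| → β u = 0) :
    ContDiff ℝ 2 (relF2 α κ L β) := by
  rw [contDiff_iff_contDiffAt]
  intro t
  by_cases ht : 0 < t
  · have h1 : relF2 α κ L β =ᶠ[nhds t] fun t => Real.exp (-(α / 2) * Real.log t) * β (κ * Real.log t - L) := by
      filter_upwards [lt_mem_nhds ht] with s hs
      rw [relF2, if_pos hs]
    refine ContDiffAt.congr_of_eventuallyEq ?_ h1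
    have h2 : ContDiffAt ℝ 2 Real.log t := Real.contDiffAt_log.2 ht.ne'
    refine ContDiffAt.mul ?_ ?_
    · exact Real.contDiff_exp.contDiffAt.comp t (contDiffAt_const.mul h2)
    · exact hb.contDiffAt.comp t ((contDiffAt_const.mul h2).sub contDiffAt_const)
  · have h1 : relF2 α κ L β =ᶠ[nhds t] fun t => 0 := by
      have : t < Real.exp ((L - 2) / κ) := lt_of_le_of_lt (not_lt.1 ht) (Real.exp_pos _)
      filter_upwards [gt_mem_nhds this] with s hs
      exact relF2_zero hκ hβ (Or.inl hs.le)
    exact contDiffAt_const.congr_of_eventuallyEq h1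

theorem relF2_deriv {α κ L : ℝ} {β : ℝ → ℝ} (hb : ContDiff ℝ 2 β) {t : ℝ} (ht : 0 < t) :
    deriv (relF2 α κ L β) t = Real.exp (-(α / 2) * Real.log t) * 
      (-(α / 2) * β (κ * Real.log t - L) + κ * deriv β (κ * Real.log t - L)) / t ∧ 
    deriv (deriv (relF2 α κ L β)) t = Real.exp (-(α / 2) * Real.log t) * 
      ((-(α / 2)) * (-(α / 2) * β (κ * Real.log t - L) + κ * deriv β (κ * Real.log t - L)) +
       (-(α / 2) * κ * deriv β (κ * Real.log t - L) + κ * κ * deriv (deriv β) (κ * Real.log t - L)) -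
       (-(α / 2) * β (κ * Real.log t - L) + κ * deriv β (κ * Real.log t - L))) / t ^ 2 := by
  have hb' : ContDiff ℝ 1 (deriv β) := hb.deriv'
  have A : ∀ s, 0 < s → HasDerivAt (fun t => Real.exp (-(α / 2) * Real.log t)) (Real.exp (-(α / 2) * Real.log s) * (-(α/2) * s⁻¹)) s := 
    fun s hs => ((Real.hasDerivAt_log hs.ne').const_mul (-(α/2))).exp
  have U : ∀ s, 0 < s → HasDerivAt (fun t => κ * Real.log t - L) (κ * s⁻¹) s := 
    fun s hs => ((Real.hasDerivAt_log hs.ne').const_mul κ).sub_const L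
  have B0 : ∀ s, 0 < s → HasDerivAt (fun t => β (κ * Real.log t - L)) (deriv β (κ * Real.log s - L) * (κ * s⁻¹)) s := 
    fun s hs => ((hb.differentiable (by norm_num)).differentiableAt.hasDerivAt (x := κ * Real.log s - L)).comp s (U s hs)
  have B1 : ∀ s, 0 < s → HasDerivAt (fun t => deriv β (κ * Real.log t - L)) (deriv (deriv β) (κ * Real.log s - L) * (κ * s⁻¹)) s := 
    fun s hs => by
      have h := (hb'.differentiable (by norm_num)).differentiableAt.hasDerivAt (x := κ * Real.log s - L)
      exact HasDerivAt.comp (h₂ := deriv β) s h (U s hs)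
  have D : ∀ s, 0 < s → deriv (relF2 α κ L β) s = Real.exp (-(α / 2) * Real.log s) * 
      (-(α / 2) * β (κ * Real.log s - L) + κ * deriv β (κ * Real.log s - L)) / s := fun s hs => by
    have h1 : relF2 α κ L β =ᶠ[nhds s] fun t => Real.exp (-(α / 2) * Real.log t) * β (κ * Real.log t - L) := by
      filter_upwards [lt_mem_nhds hs] with s hs
      rw [relF2, if_pos hs]
    rw [h1.deriv_eq]
    refine ((A s hs).mul (B0 s hs)).deriv.trans ?_
    field_simp
  refine ⟨D t ht, ?_⟩
  have h1 : deriv (relF2 α κ L β) =ᶠ[nhds t] fun s => Real.exp (-(α / 2) * Real.log s) * 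
      (-(α / 2) * β (κ * Real.log s - L) + κ * deriv β (κ * Real.log s - L)) / s := by
    filter_upwards [lt_mem_nhds ht] with s hs using D s hs
  rw [h1.deriv_eq]
  refine (((A t ht).mul (((B0 t ht).const_mul (-(α/2))).add ((B1 t ht).const_mul κ))).div (hasDerivAt_id t) ht.ne').deriv.trans ?_
  simp only [Pi.add_apply, Pi.mul_apply, id]
  field_simp

theorem relF2_comb {α κ L m w : ℝ} {β : ℝ → ℝ} (hb : ContDiff ℝ 2 β) {t : ℝ} (ht : 0 < t) :
    4 * t * deriv (deriv (relF2 α κ L β)) t + (2 * m + 2 * w) * deriv (relF2 α κ L β) t =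
    Real.exp (-(α / 2) * Real.log t) / t * ((α ^ 2 - α * (m - 2 + w)) * β (κ * Real.log t - L) + 
      κ * (-4 * α + 2 * m - 4 + 2 * w) * deriv β (κ * Real.log t - L) + 
      4 * κ ^ 2 * deriv (deriv β) (κ * Real.log t - L)) := by
  rw [(relF2_deriv hb ht).1, (relF2_deriv hb ht).2]
  field_simp
  ring


theorem rel_infDist_eq {d : ℕ} (K : Set (EuclideanSpace ℝ (Fin d))) 
    (W : Submodule ℝ (EuclideanSpace ℝ (Fin d))) (hW : W = (affineSpan ℝ K).direction)
    (a : EuclideanSpace ℝ (Fin d)) (ha : a ∈ K) (R : ℝ) (hball : ∀ w ∈ W, ‖w‖ ≤ R → a + w ∈ K)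
    (x : EuclideanSpace ℝ (Fin d)) (hx : ‖W.starProjection (x - a)‖ ≤ R) :
    Metric.infDist x K = ‖Wᗮ.starProjection (x - a)‖ := by
  have hs := W.starProjection_add_starProjection_orthogonal (x - a)
  apply le_antisymm
  · have := Metric.infDist_le_dist_of_mem (x := x) (hball _ (W.starProjection_apply_mem (x - a)) hx)
    refine this.trans (le_of_eq ?_)
    rw [dist_eq_norm]
    congr 1
    rw [← sub_sub]
    exact sub_eq_of_eq_add' hs.symm
  · refine (Metric.le_infDist ⟨a, ha⟩).2 fun y hy => ?_
    have hya : y - a ∈ W := by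
      rw [hW]
      exact AffineSubspace.vsub_mem_direction (subset_affineSpan ℝ K hy) (subset_affineSpan ℝ K ha)
    have h0 : Wᗮ.starProjection (y - a) = 0 := by
      rw [Submodule.starProjection_apply_eq_zero_iff]
      exact Submodule.le_orthogonal_orthogonal W hya
    have h1 : Wᗮ.starProjection (x - a) = Wᗮ.starProjection (x - y) := by
      have : x - a = (x - y) + (y - a) := by abel
      rw [this, map_add, h0, add_zero]
    rw [h1, dist_eq_norm]
    exact Submodule.norm_starProjection_apply_le _ _

def relc (δ δ' s : ℝ) : ℝ := s ^ δ * (1 + s) ^ (δ' - δ)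
def relw (δ δ' s : ℝ) : ℝ := δ + (δ' - δ) * (s / (1 + s))

theorem relc_deriv {δ δ' s : ℝ} (hs : 0 < s) :
    HasDerivAt (relc δ δ') (relc δ δ' s * relw δ δ' s / s) s := by
  have h1 : HasDerivAt (fun s : ℝ => s ^ δ) (δ * s ^ (δ - 1)) s := Real.hasDerivAt_rpow_const (Or.inl hs.ne')
  have h2 : HasDerivAt (fun s : ℝ => (1 + s) ^ (δ' - δ)) (1 * (δ' - δ) * (1 + s) ^ (δ' - δ - 1)) s :=
    ((hasDerivAt_id s).const_add 1).rpow_const (Or.inl (by simp; positivity))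
  refine HasDerivAt.congr_deriv (h1.mul h2) ?_
  have hs1 : 0 < 1 + s := by positivity
  rw [relc, relw, Real.rpow_sub_one hs.ne', Real.rpow_sub_one hs1.ne']
  field_simp

theorem rel_cWeight_deriv {d : ℕ} (K : Set (EuclideanSpace ℝ (Fin d))) 
    (W : Submodule ℝ (EuclideanSpace ℝ (Fin d))) (hW : W = (affineSpan ℝ K).direction)
    (a : EuclideanSpace ℝ (Fin d)) (ha : a ∈ K) (R : ℝ) (hball : ∀ w ∈ W, ‖w‖ ≤ R → a + w ∈ K)
    (δ δ' : ℝ) (x : EuclideanSpace ℝ (Fin d)) (hx : ‖W.starProjection (x - a)‖ < R) (s : ℝ) 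
    (hs : s = ‖Wᗮ.starProjection (x - a)‖) (hs0 : 0 < s) :
    HasFDerivAt (cWeight K δ δ') ((relc δ δ' s * relw δ δ' s / s ^ 2) • innerSL ℝ (Wᗮ.starProjection (x - a))) x := by
  have h1 : cWeight K δ δ' =ᶠ[nhds x] fun y => relc δ δ' (Real.sqrt (‖Wᗮ.starProjection (y - a)‖ ^ 2)) := by
    have hc : Continuous fun y => ‖W.starProjection (y - a)‖ := by fun_prop
    filter_upwards [hc.continuousAt.eventually (gt_mem_nhds hx)] with y hy
    rw [cWeight, rel_infDist_eq K W hW a ha R hball y hy.le, relc, Real.sqrt_sq (norm_nonneg _)]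
  refine HasFDerivAt.congr_of_eventuallyEq ?_ h1
  have h2 := rel_normsq_deriv Wᗮ a x
  have h3 : HasDerivAt (fun t => relc δ δ' (Real.sqrt t)) (relc δ δ' s * relw δ δ' s / s * (1 / (2 * s))) (s ^ 2) := by
    have e := (Real.hasDerivAt_sqrt (x := s ^ 2) (by positivity))
    have e2 := relc_deriv (δ := δ) (δ' := δ') hs0
    have es : Real.sqrt (s ^ 2) = s := Real.sqrt_sq hs0.le
    rw [← es] at e2
    have e3 := e2.comp (s^2) e
    rw [es] at e3
    exact e3
  rw [hs] at h3
  have h4 := h3.comp_hasFDerivAt x h2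
  refine HasFDerivAt.congr_fderiv h4 ?_
  rw [← hs, smul_smul]
  congr 1
  field_simp

theorem rel_test_Hop {d : ℕ} (K : Set (EuclideanSpace ℝ (Fin d))) 
    (W : Submodule ℝ (EuclideanSpace ℝ (Fin d))) (hW : W = (affineSpan ℝ K).direction)
    (a : EuclideanSpace ℝ (Fin d)) (ha : a ∈ K) (R : ℝ) (hball : ∀ w ∈ W, ‖w‖ ≤ R → a + w ∈ K)
    (δ δ' : ℝ) (F1 F2 : ℝ → ℝ) (h1 : ContDiff ℝ 2 F1) (h2 : ContDiff ℝ 2 F2)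
    (x : EuclideanSpace ℝ (Fin d)) (hx : ‖W.starProjection (x - a)‖ < R) (s Q : ℝ) 
    (hQ : Q = ‖W.starProjection (x - a)‖ ^ 2)
    (hs : s = ‖Wᗮ.starProjection (x - a)‖) (hs0 : 0 < s) :
    Hop K δ δ' (fun x => F1 (‖W.starProjection (x - a)‖ ^ 2) * F2 (‖Wᗮ.starProjection (x - a)‖ ^ 2)) x = 
      - (relc δ δ' s * ((4 * Q * deriv (deriv F1) Q + 2 * Module.finrank ℝ W * deriv F1 Q) * F2 (s^2) +
      F1 Q * (4 * s^2 * deriv (deriv F2) (s^2) + (2 * Module.finrank ℝ Wᗮ + 2 * relw δ δ' s) * deriv F2 (s^2)))) := by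
  rw [Hop, rel_test_lapl W a F1 F2 h1 h2 x Q (s^2) hQ (by rw [hs])]
  have hc : cWeight K δ δ' x = relc δ δ' s := by
    rw [cWeight, rel_infDist_eq K W hW a ha R hball x hx.le, relc, hs]
  have hg : ⟪gradient (cWeight K δ δ') x, gradient (fun x => F1 (‖W.starProjection (x - a)‖ ^ 2) * F2 (‖Wᗮ.starProjection (x - a)‖ ^ 2)) x⟫ = 
     (relc δ δ' s * relw δ δ' s / s ^ 2) * (F1 Q * deriv F2 (s^2) * (2 * s ^ 2)) := by
    rw [gradient, InnerProductSpace.toDual_symm_apply, (rel_cWeight_deriv K W hW a ha R hball δ δ' x hx s hs hs0).fderiv]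
    simp only [smul_apply, innerSL_apply_apply, smul_eq_mul]
    rw [real_inner_comm, gradient, InnerProductSpace.toDual_symm_apply, rel_test_fderiv W a F1 F2 h1 h2]
    have o : ⟪W.starProjection (x - a), Wᗮ.starProjection (x - a)⟫ = 0 :=
      Submodule.inner_right_of_mem_orthogonal (Submodule.starProjection_apply_mem _ _) (Submodule.starProjection_apply_mem _ _)
    rw [o, real_inner_self_eq_norm_sq, ← hQ, ← hs]
    ring
  rw [hg, hc]
  field_simp
  ring

theorem rel_scal_deriv {β : ℝ → ℝ} (hb : ContDiff ℝ 2 β) (c t : ℝ) :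
    deriv (fun t => β (c * t)) t = c * deriv β (c * t) ∧ 
    deriv (deriv (fun t => β (c * t))) t = c * (c * deriv (deriv β) (c * t)) := by
  have hb' : ContDiff ℝ 1 (deriv β) := hb.deriv'
  have A : ∀ t, HasDerivAt (fun t => c * t) c t := fun t => by simpa using (hasDerivAt_id t).const_mul c
  have h1 : ∀ t, deriv (fun t => β (c * t)) t = c * deriv β (c * t) := fun t => by
    have h := (hb.differentiable (by norm_num)).differentiableAt.hasDerivAt (x := c * t)
    rw [mul_comm c (deriv β _)]
    exact (HasDerivAt.comp (h₂ := β) t h (A t)).deriv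
  refine ⟨h1 t, ?_⟩
  rw [funext h1]
  have h := (hb'.differentiable (by norm_num)).differentiableAt.hasDerivAt (x := c * t)
  rw [mul_comm c (deriv (deriv β) _)]
  exact ((HasDerivAt.comp (h₂ := deriv β) t h (A t)).const_mul c).deriv


theorem rel_abs_le {a b A B : ℝ} (ha : |a| ≤ A) (hb : |b| ≤ B) : |a * b| ≤ A * B := by
  rw [abs_mul]
  exact mul_le_mul ha hb (abs_nonneg _) ((abs_nonneg _).trans ha)

set_option maxHeartbeats 1000000 in
theorem rel_num {p θ α m k ε ρ s Q c w b1 b1' b1'' b2 b2' b2'' M E C : ℝ} (hp : 1 < p) (hθ : 0 ≤ θ)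
    (hα : α = m / p + θ - 2) (hα0 : 0 < α) (hC : C = (p - 1) * m * (m + p * θ - 2 * p) / p ^ 2)
    (hm : 0 ≤ m) (hk : 0 ≤ k)
    (hε : 0 < ε) (hε1 : ε ≤ 1) (hρ : 0 < ρ) (hs : 0 < s) (hsε : s ^ 2 ≤ ε * ρ ^ 2) (hQ : 0 ≤ Q) (hQρ : Q ≤ 2 * ρ ^ 2)
    (hc : 0 ≤ c) (hw : |w - θ| ≤ ε) (h1 : 0 ≤ b1) (h1' : b1 ≤ 1) (h2 : 0 ≤ b2) (h2' : b2 ≤ 1) (hE : 0 < E)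
    (hb1 : |b1'| ≤ M) (hb1' : |b1''| ≤ M) (hb2 : |b2'| ≤ M) (hb2' : |b2''| ≤ M) (hM : 0 ≤ M) :
    |-(c * ((4 * Q * ((ρ^2)⁻¹ * ((ρ^2)⁻¹ * b1'')) + 2 * k * ((ρ^2)⁻¹ * b1')) * (E * b2) +
      b1 * (E / s ^ 2 * ((α ^ 2 - α * (m - 2 + w)) * b2 + 
      ε * (-4 * α + 2 * m - 4 + 2 * w) * b2' + 4 * ε ^ 2 * b2''))))| ≤ 
      c * (E / s ^ 2) * (C * b1 * b2 + ε * (8 * M + 2 * k * M + α + (4 * α + 2 * m + 4 + 2 * (θ + 1)) * M + 4 * M)) := by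
  have hp0 : 0 < p := by linarith
  have hC0 : C = α * m * (p - 1) / p := by
    rw [hC, hα]; field_simp
  have hCn : 0 ≤ C := by rw [hC0]; have : 0 ≤ p - 1 := by linarith
                         positivity
  have hid : α ^ 2 - α * (m - 2 + w) = - C - α * (w - θ) := by
    rw [hC0, hα]; field_simp; ring
  have e : -(c * ((4 * Q * ((ρ^2)⁻¹ * ((ρ^2)⁻¹ * b1'')) + 2 * k * ((ρ^2)⁻¹ * b1')) * (E * b2) +
      b1 * (E / s ^ 2 * ((α ^ 2 - α * (m - 2 + w)) * b2 + 
      ε * (-4 * α + 2 * m - 4 + 2 * w) * b2' + 4 * ε ^ 2 * b2'')))) =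
     -(c * (E / s ^ 2) * (((s ^ 2 * (ρ^2)⁻¹) * (4 * (Q * (ρ^2)⁻¹)) * (b1'' * b2) + (s ^ 2 * (ρ^2)⁻¹) * (2 * k) * (b1' * b2)) + 
        (-C * b1 * b2 + (w - θ) * -α * (b1 * b2) + ε * (-4 * α + 2 * m - 4 + 2 * w) * (b2' * b1) + ε * (4 * ε) * (b2'' * b1)))) := by
    rw [hid]; field_simp; ring
  rw [e, abs_neg, abs_mul, abs_of_nonneg (by positivity : 0 ≤ c * (E / s ^ 2))]
  refine mul_le_mul_of_nonneg_left ?_ (by positivity)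
  have r1 : |s ^ 2 * (ρ^2)⁻¹| ≤ ε := by
    rw [abs_of_nonneg (by positivity), ← div_eq_mul_inv, div_le_iff₀ (by positivity)]; exact hsε
  have r2 : |4 * (Q * (ρ^2)⁻¹)| ≤ 8 := by
    have : Q * (ρ^2)⁻¹ ≤ 2 := by
      rw [← div_eq_mul_inv, div_le_iff₀ (by positivity)]; exact hQρ
    rw [abs_of_nonneg (by positivity)]; linarith
  have r3 : |b1| ≤ 1 := by rwa [abs_of_nonneg h1]
  have r4 : |b2| ≤ 1 := by rwa [abs_of_nonneg h2]
  have r5 : |-4 * α + 2 * m - 4 + 2 * w| ≤ 4 * α + 2 * m + 4 + 2 * (θ + 1) := by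
    rw [abs_le] at hw ⊢
    constructor <;> linarith
  have r6 : |4 * ε| ≤ 4 := by rw [abs_of_pos (by positivity)]; linarith
  have rε : |ε| ≤ ε := (abs_of_pos hε).le
  have t1 := rel_abs_le (rel_abs_le r1 r2) (rel_abs_le hb1' r4)
  have t2 := rel_abs_le (rel_abs_le r1 (abs_of_nonneg (by positivity : 0 ≤ 2 * k)).le) (rel_abs_le hb1 r4)
  have t3 := rel_abs_le (rel_abs_le hw (by rw [abs_neg, abs_of_pos hα0] : |-α| ≤ α)) (rel_abs_le r3 r4)
  have t4 := rel_abs_le (rel_abs_le rε r5) (rel_abs_le hb2 r3)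
  have t5 := rel_abs_le (rel_abs_le rε r6) (rel_abs_le hb2' r3)
  have t6 : |-C * b1 * b2| ≤ C * b1 * b2 := by
    rw [neg_mul, neg_mul, abs_neg, abs_of_nonneg (by positivity)]
  refine (abs_add_le _ _).trans ?_
  refine (add_le_add (abs_add_le _ _) ((abs_add_le _ _).trans (add_le_add_left ((abs_add_le _ _).trans (add_le_add_left (abs_add_le _ _) _)) _))).trans ?_
  linarith [t1, t2, t3, t4, t5, t6]

theorem rel_convex_pow {p τ u v : ℝ} (hp : 1 < p) (hτ : 0 < τ) (hτ1 : τ < 1) (hu : 0 ≤ u) (hv : 0 ≤ v) :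
    (u + v) ^ p ≤ (1 - τ) * (u / (1 - τ)) ^ p + τ * (v / τ) ^ p := by
  have h1 : 0 < 1 - τ := by linarith
  have := (convexOn_rpow hp.le).2 (x := u / (1 - τ)) (y := v / τ) (by simp; positivity) (by simp; positivity) h1.le hτ.le (by ring)
  simp only [smul_eq_mul] at this
  rwa [mul_div_cancel₀ _ h1.ne', mul_div_cancel₀ _ hτ.ne'] at this

set_option maxHeartbeats 4000000 in
theorem rel_test {d : ℕ} (K : Set (EuclideanSpace ℝ (Fin d))) (hKcl : IsClosed K)
    (W : Submodule ℝ (EuclideanSpace ℝ (Fin d))) (hW : W = (affineSpan ℝ K).direction)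
    (m : ℕ) (hm : Module.finrank ℝ Wᗮ = m) (hm1 : 1 ≤ m) (p δ δ' θ α C : ℝ) (hp : 1 < p) (hθ : 0 ≤ θ)
    (hα : α = m / p + θ - 2) (hα0 : 0 < α) (hC : C = (p - 1) * m * (m + p * θ - 2 * p) / p ^ 2) 
    (β : ℝ → ℝ) (M : ℝ) (hβc : ContDiff ℝ 2 β) (hβ0 : ∀ u, 0 ≤ β u) (hβ1 : ∀ u, β u ≤ 1)
    (hβ2 : ∀ u, |u| ≤ 1 → β u = 1) (hβ3 : ∀ u, 2 ≤ |u| → β u = 0) (hM : 0 ≤ M) (hM1 : ∀ u, |deriv β u| ≤ M)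
    (hM2 : ∀ u, |deriv (deriv β) u| ≤ M) (ε τ : ℝ) (hε : 0 < ε) (hε1 : ε ≤ 1) (hτ : 0 < τ) (hτ1 : τ < 1)
    (a : EuclideanSpace ℝ (Fin d)) (ha : a ∈ K) (ρ L : ℝ) (hρ : 0 < ρ) (hball : ∀ w ∈ W, ‖w‖ ≤ 2 * ρ → a + w ∈ K)
    (hT : ∀ s, 0 < s → Real.exp ((L - 2) / ε) ≤ s ^ 2 → s ^ 2 ≤ Real.exp ((L + 2) / ε) → 
      |relw δ δ' s - θ| ≤ ε ∧ 1 / 2 ≤ relc δ δ' s * s ^ (-θ) ∧ relc δ δ' s * s ^ (-θ) ≤ 2 ∧ s ^ 2 ≤ ε * ρ ^ 2) 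
    (Λ : ℝ) (hΛ : Λ = 8 * M + 2 * Module.finrank ℝ W * M + α + (4 * α + 2 * m + 4 + 2 * (θ + 1)) * M + 4 * M) :
    nuP d p δ δ' K ≤ (1 - τ) * (C / (1 - τ)) ^ p + 
      τ * ((ε * Λ) / τ) ^ p * 2 ^ p * (2 * 2 ^ (Module.finrank ℝ W)) * 2 ^ p := by
  have hp0 : 0 < p := by linarith
  have hKne : K.Nonempty := ⟨a, ha⟩
  set F1 : ℝ → ℝ := fun t => β ((ρ^2)⁻¹ * t) with hF1
  set F2 : ℝ → ℝ := relF2 α ε L β with hF2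
  have hF1c : ContDiff ℝ 2 F1 := hβc.comp (contDiff_const.mul contDiff_id)
  have hF2c : ContDiff ℝ 2 F2 := relF2_contDiff hε hβc hβ3
  set φ : EuclideanSpace ℝ (Fin d) → ℝ := fun x => F1 (‖W.starProjection (x - a)‖ ^ 2) * F2 (‖Wᗮ.starProjection (x - a)‖ ^ 2) with hφd
  set t0 := Real.exp ((L - 2) / ε) with ht0
  set t1 := Real.exp ((L + 2) / ε) with ht1
  have ht0p : 0 < t0 := Real.exp_pos _
  set S : Set (EuclideanSpace ℝ (Fin d)) := {x | ‖W.starProjection (x - a)‖ ^ 2 ≤ 2 * ρ ^ 2} ∩ 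
    ({x | t0 ≤ ‖Wᗮ.starProjection (x - a)‖ ^ 2} ∩ {x | ‖Wᗮ.starProjection (x - a)‖ ^ 2 ≤ t1}) with hS
  have hScl : IsClosed S := (isClosed_le (by fun_prop) (by fun_prop)).inter ((isClosed_le (by fun_prop) (by fun_prop)).inter (isClosed_le (by fun_prop) (by fun_prop)))
  have hScp : IsCompact S := by
    refine (isCompact_closedBall a (Real.sqrt (2 * ρ ^ 2 + t1))).of_isClosed_subset hScl fun x hx => ?_
    rw [Metric.mem_closedBall, dist_eq_norm]
    apply Real.le_sqrt_of_sq_le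
    rw [W.norm_sq_eq_add_norm_sq_starProjection (x - a)]
    exact add_le_add hx.1 hx.2.2
  have hSK : S ⊆ Kᶜ := fun x hx hxK => by
    have hxa : x - a ∈ W := by
      rw [hW]
      exact AffineSubspace.vsub_mem_direction (subset_affineSpan ℝ K hxK) (subset_affineSpan ℝ K ha)
    have h0 : Wᗮ.starProjection (x - a) = 0 := by
      rw [Submodule.starProjection_apply_eq_zero_iff]
      exact Submodule.le_orthogonal_orthogonal W hxa
    have h1 : t0 ≤ ‖Wᗮ.starProjection (x - a)‖ ^ 2 := hx.2.1
    rw [h0] at h1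
    norm_num at h1; linarith
  have hφS : ∀ x, x ∉ S → φ x = 0 := fun x hx => by
    by_contra h
    apply hx
    have h1 : F1 (‖W.starProjection (x - a)‖ ^ 2) ≠ 0 := left_ne_zero_of_mul h
    have h2 : F2 (‖Wᗮ.starProjection (x - a)‖ ^ 2) ≠ 0 := right_ne_zero_of_mul h
    refine ⟨?_, ?_, ?_⟩
    · show ‖W.starProjection (x - a)‖ ^ 2 ≤ 2 * ρ ^ 2
      by_contra h3
      apply h1
      rw [hF1]
      apply hβ3
      rw [abs_of_nonneg (by positivity), inv_mul_eq_div, le_div_iff₀ (by positivity)]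
      linarith
    · show t0 ≤ ‖Wᗮ.starProjection (x - a)‖ ^ 2
      by_contra h3
      exact h2 (relF2_zero hε hβ3 (Or.inl (not_le.1 h3).le))
    · show ‖Wᗮ.starProjection (x - a)‖ ^ 2 ≤ t1
      by_contra h3
      exact h2 (relF2_zero hε hβ3 (Or.inr (not_le.1 h3).le))
  have hφc : ContDiff ℝ 2 φ := by
    have c1 : ContDiff ℝ 2 fun x => ‖W.starProjection (x - a)‖ ^ 2 := 
      (W.starProjection.contDiff.comp (contDiff_id.sub contDiff_const)).norm_sq ℝ
    have c2 : ContDiff ℝ 2 fun x => ‖Wᗮ.starProjection (x - a)‖ ^ 2 := 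
      (Wᗮ.starProjection.contDiff.comp (contDiff_id.sub contDiff_const)).norm_sq ℝ
    exact (hF1c.comp c1).mul (hF2c.comp c2)
  have hφcs : HasCompactSupport φ := HasCompactSupport.intro hScp hφS
  have hφts : tsupport φ ⊆ S := closure_minimal (fun x hx => by by_contra h; exact hx (hφS x h)) hScl
  have hφK : tsupport φ ⊆ Kᶜ := hφts.trans hSK
  have hφ0 : φ ≠ 0 := by
    have : Nontrivial Wᗮ := Module.nontrivial_of_finrank_pos (R := ℝ) (by omega)
    obtain ⟨v, hv⟩ := exists_norm_eq Wᗮ (Real.exp_pos (L / ε / 2)).le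
    intro h
    have h1 := congrFun h (a + v)
    have e1 : W.starProjection (v : EuclideanSpace ℝ (Fin d)) = 0 := (Submodule.starProjection_apply_eq_zero_iff W).2 v.2
    have e2 : Wᗮ.starProjection (v : EuclideanSpace ℝ (Fin d)) = v := Submodule.starProjection_eq_self_iff.2 v.2
    have e3 : ‖(v : EuclideanSpace ℝ (Fin d))‖ ^ 2 = Real.exp (L / ε) := by
      have hv2 : ‖(v : EuclideanSpace ℝ (Fin d))‖ = Real.exp (L / ε / 2) := hv
      rw [hv2, ← Real.exp_nat_mul]; congr 1; push_cast; ring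
    simp only [hφd, add_sub_cancel_left, e1, e2, e3, Pi.zero_apply, hF1, hF2, relF2, Real.exp_pos, if_true, Real.log_exp] at h1
    rw [hβ2 _ (by simp), hβ2 _ (by rw [mul_div_cancel₀ _ hε.ne']; simp)] at h1
    simp at h1
  -- integrals
  set Bf : EuclideanSpace ℝ (Fin d) → ℝ := fun x => (cWeight K δ δ' x * Metric.infDist x K ^ (-(2 : ℝ))) ^ p * |φ x| ^ p with hBf
  have hnu : nuP d p δ δ' K ≤ (∫ x, |Hop K δ δ' φ x| ^ p) / (∫ x, Bf x) := by
    unfold nuP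
    refine csInf_le ⟨0, ?_⟩ ⟨φ, hφc, hφcs, hφK, hφ0, ?_⟩
    · rintro r ⟨ψ, -, -, -, -, rfl⟩
      refine div_nonneg (integral_nonneg fun x => by positivity) (integral_nonneg fun x => ?_)
      have : 0 ≤ Metric.infDist x K := Metric.infDist_nonneg
      simp only [cWeight, Pi.zero_apply]
      positivity
    · have hKT : ∀ x, x ∉ Kᶜ → x ∉ tsupport φ := fun x hx h => hx (hφK h)
      rw [setIntegral_eq_integral_of_forall_compl_eq_zero (fun x hx => by
          rw [rel_Hop_off (hKT x hx)]; simp [hp0.ne']),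
        setIntegral_eq_integral_of_forall_compl_eq_zero (fun x hx => by
          rw [image_eq_zero_of_notMem_tsupport (hKT x hx)]; simp [hp0.ne'])]
  have hBi : Integrable Bf := by
    have h := rel_continuous_off (K := K) (f := Bf) hφcs hφK (fun x hx => ?_) (fun x hx => ?_)
    · exact h.1.integrable_of_hasCompactSupport h.2
    · have h1 := rel_rpow_cont hKcl hKne δ hx
      have h2 := rel_rpow_cont hKcl hKne (-(2:ℝ)) hx
      have h0 := rel_infDist_pos hKcl hKne hx
      have h3 : ContinuousAt (fun x => (1 + Metric.infDist x K) ^ (δ' - δ)) x :=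
        (continuous_const.add (Metric.continuous_infDist_pt K)).continuousAt.rpow_const (Or.inl (by simp; positivity))
      exact (((h1.mul h3).mul h2).rpow_const (Or.inr hp0.le)).mul (hφc.continuous.continuousAt.abs.rpow_const (Or.inr hp0.le))
    · rw [hBf]; simp only [image_eq_zero_of_notMem_tsupport hx]; simp [hp0.ne']
  set J1 : EuclideanSpace ℝ (Fin d) → ℝ := fun x => relBall (2 * ρ) (W.starProjection (x - a)) * relAnn m t0 t1 (Wᗮ.starProjection (x - a)) with hJ1
  set J0 : EuclideanSpace ℝ (Fin d) → ℝ := fun x => relBall ρ (W.starProjection (x - a)) * 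
        relAnn m (Real.exp ((L - 1) / ε)) (Real.exp ((L + 1) / ε)) (Wᗮ.starProjection (x - a)) with hJ0
  have hJ : ∫ x, J1 x ≤ 2 * 2 ^ (Module.finrank ℝ W) * ∫ x, J0 x := rel_meas_compare W a m hm ρ ε L
  have hJ1i : Integrable J1 := by
    have hc1 : IsClosed ({x : EuclideanSpace ℝ (Fin d) | ‖W.starProjection (x - a)‖ ≤ 2 * ρ} ∩ 
      ({x | t0 ≤ ‖Wᗮ.starProjection (x - a)‖ ^ 2} ∩ {x | ‖Wᗮ.starProjection (x - a)‖ ^ 2 ≤ t1})) := (isClosed_le (by fun_prop) (by fun_prop)).inter ((isClosed_le (by fun_prop) (by fun_prop)).inter (isClosed_le (by fun_prop) (by fun_prop)))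
    have hc2 : IsCompact ({x : EuclideanSpace ℝ (Fin d) | ‖W.starProjection (x - a)‖ ≤ 2 * ρ} ∩ 
      ({x | t0 ≤ ‖Wᗮ.starProjection (x - a)‖ ^ 2} ∩ {x | ‖Wᗮ.starProjection (x - a)‖ ^ 2 ≤ t1})) := by
      refine (isCompact_closedBall a (Real.sqrt ((2 * ρ) ^ 2 + t1))).of_isClosed_subset hc1 fun x hx => ?_
      rw [Metric.mem_closedBall, dist_eq_norm]
      apply Real.le_sqrt_of_sq_le
      rw [W.norm_sq_eq_add_norm_sq_starProjection (x - a)]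
      exact add_le_add (pow_le_pow_left₀ (norm_nonneg _) hx.1 2) hx.2.2
    have : J1 = ({x : EuclideanSpace ℝ (Fin d) | ‖W.starProjection (x - a)‖ ≤ 2 * ρ} ∩ 
      ({x | t0 ≤ ‖Wᗮ.starProjection (x - a)‖ ^ 2} ∩ {x | ‖Wᗮ.starProjection (x - a)‖ ^ 2 ≤ t1})).indicator (fun x => ‖Wᗮ.starProjection (x - a)‖ ^ (-(m:ℝ))) := by
      classical
      ext x
      simp only [hJ1, relBall, relAnn, indicator, mem_inter_iff, mem_ofPred_eq]
      generalize ‖W.starProjection (x - a)‖ = q1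
      generalize ‖Wᗮ.starProjection (x - a)‖ = q2
      by_cases h1 : q1 ≤ 2 * ρ
      · simp only [h1, if_true, one_mul, true_and]
      · simp only [h1, if_false, zero_mul, false_and]
    rw [this, integrable_indicator_iff hc1.measurableSet]
    refine ContinuousOn.integrableOn_compact hc2 fun x hx => ?_
    have hcc : Continuous fun x => ‖Wᗮ.starProjection (x - a)‖ := by fun_prop
    refine (hcc.continuousAt.rpow_const (Or.inl ?_)).continuousWithinAt
    intro h
    have := hx.2.1
    simp only [mem_ofPred_eq, h] at this
    norm_num at this; linarith
  -- key facts on S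
  have hfacts : ∀ x, ‖W.starProjection (x - a)‖ ≤ 2 * ρ → t0 ≤ ‖Wᗮ.starProjection (x - a)‖ ^ 2 → ‖Wᗮ.starProjection (x - a)‖ ^ 2 ≤ t1 →
     ∃ s, s = ‖Wᗮ.starProjection (x - a)‖ ∧ 0 < s ∧ Metric.infDist x K = s ∧ cWeight K δ δ' x = relc δ δ' s ∧ 0 ≤ relc δ δ' s ∧ 
      (relc δ δ' s * s ^ (-(2:ℝ)) * s ^ (-α)) ^ p = (relc δ δ' s * s ^ (-θ)) ^ p * s ^ (-(m:ℝ)) ∧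
      F2 (‖Wᗮ.starProjection (x - a)‖ ^ 2) = s ^ (-α) * β (ε * Real.log (s ^ 2) - L) ∧ Real.exp (-(α / 2) * Real.log (s ^ 2)) = s ^ (-α) := by
    intro x hx1 hx2 hx3
    have hs : 0 < ‖Wᗮ.starProjection (x - a)‖ := by
      by_contra h
      have : ‖Wᗮ.starProjection (x - a)‖ = 0 := le_antisymm (not_lt.1 h) (norm_nonneg _)
      rw [this] at hx2; norm_num at hx2; linarith
    set s := ‖Wᗮ.starProjection (x - a)‖
    have hd : Metric.infDist x K = s := rel_infDist_eq K W hW a ha _ hball x hx1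
    have he : Real.exp (-(α / 2) * Real.log (s ^ 2)) = s ^ (-α) := by
      rw [Real.rpow_def_of_pos hs, Real.log_pow]; congr 1; push_cast; ring
    refine ⟨s, rfl, hs, hd, by rw [cWeight, hd, relc], by unfold relc; positivity, ?_, ?_, he⟩
    · have hc : 0 ≤ relc δ δ' s := by unfold relc; positivity
      have : s ^ (-(m:ℝ)) = (s ^ (θ - 2 - α)) ^ p := by
        rw [← Real.rpow_mul hs.le]; congr 1; rw [hα]; field_simp; ring
      rw [this, ← Real.mul_rpow (by positivity) (by positivity)]
      congr 1
      rw [mul_assoc, mul_assoc, ← Real.rpow_add hs, ← Real.rpow_add hs]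
      congr 2; ring
    · rw [hF2, relF2, if_pos (by positivity), he]
  have hBn : ∀ x, 0 ≤ Bf x := fun x => by
    have : 0 ≤ Metric.infDist x K := Metric.infDist_nonneg
    simp only [hBf, cWeight]
    positivity
  -- J0 ≤ 2^p B
  have hJ0B : ∫ x, J0 x ≤ 2 ^ p * ∫ x, Bf x := by
    rw [← integral_const_mul]
    refine integral_mono_of_nonneg (.of_forall fun x => mul_nonneg (relBall_nonneg _ _) (relAnn_nonneg _ _ _ _)) (hBi.const_mul _) (.of_forall fun x => ?_)
    show J0 x ≤ 2 ^ p * Bf x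
    have hn : 0 ≤ 2 ^ p * Bf x := mul_nonneg (by positivity) (hBn x)
    by_cases h1 : ‖W.starProjection (x - a)‖ ≤ ρ
    swap
    · simpa only [hJ0, relBall, if_neg h1, zero_mul] using hn
    by_cases h2 : Real.exp ((L - 1) / ε) ≤ ‖Wᗮ.starProjection (x - a)‖ ^ 2 ∧ ‖Wᗮ.starProjection (x - a)‖ ^ 2 ≤ Real.exp ((L + 1) / ε)
    swap
    · simpa only [hJ0, relAnn, if_neg h2, mul_zero] using hn
    have h3 : t0 ≤ ‖Wᗮ.starProjection (x - a)‖ ^ 2 := le_trans (by rw [ht0]; gcongr; norm_num) h2.1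
    have h4 : ‖Wᗮ.starProjection (x - a)‖ ^ 2 ≤ t1 := h2.2.trans (by rw [ht1]; gcongr; norm_num)
    obtain ⟨s, hs, hs0, hd, hcw, hc0, hpw, hF2s, -⟩ := hfacts x (by linarith) h3 h4
    have hb1 : F1 (‖W.starProjection (x - a)‖ ^ 2) = 1 := by
      rw [hF1]; apply hβ2
      rw [abs_of_nonneg (by positivity), inv_mul_eq_div, div_le_one (by positivity)]
      gcongr
    have hb2 : β (ε * Real.log (s ^ 2) - L) = 1 := by
      apply hβ2
      rw [← hs] at h2
      have hs2 : 0 < s ^ 2 := by positivity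
      have a1 := (Real.le_log_iff_exp_le hs2).2 h2.1
      have a2 := (Real.log_le_iff_le_exp hs2).2 h2.2
      rw [div_le_iff₀ hε] at a1
      rw [le_div_iff₀ hε] at a2
      rw [abs_le]; constructor <;> linarith
    have hφx : φ x = s ^ (-α) := by
      simp only [hφd, hb1, hF2s, hb2]; ring
    have hJ0x : J0 x = s ^ (-(m:ℝ)) := by
      simp only [hJ0, relBall, relAnn]
      rw [if_pos h1, if_pos h2, one_mul, hs]
    rw [hJ0x]
    simp only [hBf, hφx, hd, hcw]
    rw [abs_of_pos (by positivity), ← Real.mul_rpow (by positivity) (by positivity), hpw, ← mul_assoc,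
      ← Real.mul_rpow (by positivity) (by positivity)]
    have := (hT s hs0 (by rw [hs]; exact h3) (by rw [hs]; exact h4)).2.1
    exact le_mul_of_one_le_left (by positivity) (Real.one_le_rpow (by linarith) hp0.le)
  -- A bound
  have hA : ∫ x, |Hop K δ δ' φ x| ^ p ≤ (1 - τ) * (C / (1 - τ)) ^ p * (∫ x, Bf x) + τ * ((ε * Λ) / τ) ^ p * 2 ^ p * ∫ x, J1 x := by
    rw [← integral_const_mul, ← integral_const_mul, ← integral_add (hBi.const_mul _) (hJ1i.const_mul _)]
    have hΛ0 : 0 ≤ Λ := by rw [hΛ]; positivity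
    have hC0 : 0 ≤ C := by
      have : C = α * m * (p - 1) / p := by rw [hC, hα]; field_simp
      rw [this]; have : 0 ≤ p - 1 := by linarith
      positivity
    have hτ' : 0 < 1 - τ := by linarith
    refine integral_mono_of_nonneg (.of_forall fun x => by positivity) ((hBi.const_mul _).add (hJ1i.const_mul _)) (.of_forall fun x => ?_)
    show |Hop K δ δ' φ x| ^ p ≤ (1 - τ) * (C / (1 - τ)) ^ p * Bf x + τ * ((ε * Λ) / τ) ^ p * 2 ^ p * J1 x
    by_cases hx : x ∈ S
    swap
    · rw [rel_Hop_off (fun h => hx (hφts h)), abs_zero, Real.zero_rpow hp0.ne']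
      have := hBn x
      have : 0 ≤ J1 x := mul_nonneg (relBall_nonneg _ _) (relAnn_nonneg _ _ _ _)
      positivity
    have hx1 : ‖W.starProjection (x - a)‖ < 2 * ρ := by
      have : ‖W.starProjection (x - a)‖ ^ 2 ≤ 2 * ρ ^ 2 := hx.1
      apply lt_of_pow_lt_pow_left₀ 2 (by positivity)
      nlinarith
    obtain ⟨s, hs, hs0, hd, hcw, hc0, hpw, hF2s, hexp⟩ := hfacts x hx1.le hx.2.1 hx.2.2
    obtain ⟨T1, T2, T3, T4⟩ := hT s hs0 (by rw [hs]; exact hx.2.1) (by rw [hs]; exact hx.2.2)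
    have hHop := rel_test_Hop K W hW a ha _ hball δ δ' F1 F2 hF1c hF2c x hx1 s _ rfl hs hs0
    rw [hm, relF2_comb hβc (by positivity : 0 < s ^ 2), (rel_scal_deriv hβc _ _).1, (rel_scal_deriv hβc _ _).2] at hHop
    have hF2s' : F2 (s ^ 2) = s ^ (-α) * β (ε * Real.log (s ^ 2) - L) := by rw [hs]; rw [hs] at hF2s; exact hF2s
    rw [hF2s', hexp] at hHop
    have hnum := rel_num (k := Module.finrank ℝ W) hp hθ hα hα0 hC (Nat.cast_nonneg m) (Nat.cast_nonneg _) hε hε1 hρ hs0 T4 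
      (sq_nonneg ‖W.starProjection (x - a)‖) hx.1 hc0 T1 (hβ0 ((ρ^2)⁻¹ * ‖W.starProjection (x - a)‖ ^ 2)) (hβ1 _) 
      (hβ0 (ε * Real.log (s ^ 2) - L)) (hβ1 _) (Real.rpow_pos_of_pos hs0 (-α)) (hM1 ((ρ^2)⁻¹ * ‖W.starProjection (x - a)‖ ^ 2)) (hM2 ((ρ^2)⁻¹ * ‖W.starProjection (x - a)‖ ^ 2)) (hM1 (ε * Real.log (s ^ 2) - L)) (hM2 (ε * Real.log (s ^ 2) - L)) hM
    rw [← hHop, ← hΛ] at hnum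
    have hφx : φ x = β ((ρ^2)⁻¹ * ‖W.starProjection (x - a)‖ ^ 2) * (s ^ (-α) * β (ε * Real.log (s ^ 2) - L)) := by
      simp only [hφd, hF2s]; rfl
    have hφn : 0 ≤ φ x := by rw [hφx]; exact mul_nonneg (hβ0 _) (mul_nonneg (by positivity) (hβ0 _))
    have hs2 : s ^ (-(2:ℝ)) = (s ^ 2)⁻¹ := by
      rw [Real.rpow_neg hs0.le]; norm_cast
    set Y := relc δ δ' s * s ^ (-(2:ℝ)) with hY
    have hYn : 0 ≤ Y := by positivity
    have hnum2 : |Hop K δ δ' φ x| ≤ C * (Y * |φ x|) + (ε * Λ) * (Y * s ^ (-α)) := by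
      refine hnum.trans (le_of_eq ?_)
      rw [abs_of_nonneg hφn, hφx, hY, hs2]
      field_simp
    have hBx : Bf x = (Y * |φ x|) ^ p := by
      simp only [hBf, hcw, hd]
      rw [← Real.mul_rpow (by positivity) (by positivity)]
    have hJx : J1 x = s ^ (-(m:ℝ)) := by
      simp only [hJ1, relBall, relAnn]
      have hx2 : t0 ≤ ‖Wᗮ.starProjection (x - a)‖ ^ 2 ∧ ‖Wᗮ.starProjection (x - a)‖ ^ 2 ≤ t1 := hx.2
      rw [if_pos hx1.le, if_pos hx2, one_mul, hs]
    calc |Hop K δ δ' φ x| ^ p ≤ (C * (Y * |φ x|) + (ε * Λ) * (Y * s ^ (-α))) ^ p := by gcongr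
      _ ≤ (1 - τ) * (C * (Y * |φ x|) / (1 - τ)) ^ p + τ * ((ε * Λ) * (Y * s ^ (-α)) / τ) ^ p := rel_convex_pow hp hτ hτ1 (by positivity) (by positivity)
      _ = (1 - τ) * (C / (1 - τ)) ^ p * (Y * |φ x|) ^ p + τ * ((ε * Λ) / τ) ^ p * (Y * s ^ (-α)) ^ p := by
        rw [mul_div_right_comm C, mul_div_right_comm (ε * Λ), Real.mul_rpow (x := C / (1 - τ)) (by positivity) (by positivity), Real.mul_rpow (x := ε * Λ / τ) (by positivity) (by positivity)]
        ring
      _ ≤ _ := by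
        rw [hBx, hJx, hpw, mul_assoc (τ * (ε * Λ / τ) ^ p)]
        gcongr
  have hΛ0 : 0 ≤ Λ := by rw [hΛ]; positivity
  refine hnu.trans ?_
  set B := ∫ x, Bf x
  have hB0 : 0 ≤ B := integral_nonneg hBn
  have hC0 : 0 ≤ C := by
    have : C = α * m * (p - 1) / p := by rw [hC, hα]; field_simp
    rw [this]; have : 0 ≤ p - 1 := by linarith
    positivity
  have hτ' : 0 < 1 - τ := by linarith
  refine div_le_of_le_mul₀ hB0 (by positivity) ?_
  refine hA.trans ?_
  have : τ * ((ε * Λ) / τ) ^ p * 2 ^ p * ∫ x, J1 x ≤ τ * ((ε * Λ) / τ) ^ p * 2 ^ p * (2 * 2 ^ (Module.finrank ℝ W) * (2 ^ p * B)) := by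
    gcongr
    refine hJ.trans ?_
    gcongr
  linarith


theorem rel_upper {d : ℕ} (K : Set (EuclideanSpace ℝ (Fin d))) (hKcl : IsClosed K)
    (W : Submodule ℝ (EuclideanSpace ℝ (Fin d))) (hW : W = (affineSpan ℝ K).direction)
    (m : ℕ) (hm : Module.finrank ℝ Wᗮ = m) (hm1 : 1 ≤ m) (p δ δ' θ C : ℝ) (hp : 1 < p) (hθ : 0 ≤ θ)
    (hN : 0 < m + p * θ - 2 * p) (hC : C = (p - 1) * m * (m + p * θ - 2 * p) / p ^ 2)
    (H : ∀ ε : ℝ, 0 < ε → ε ≤ 1 → ∃ a ∈ K, ∃ ρ L : ℝ, 0 < ρ ∧ (∀ w ∈ W, ‖w‖ ≤ 2 * ρ → a + w ∈ K) ∧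
      ∀ s, 0 < s → Real.exp ((L - 2) / ε) ≤ s ^ 2 → s ^ 2 ≤ Real.exp ((L + 2) / ε) → 
      |relw δ δ' s - θ| ≤ ε ∧ 1 / 2 ≤ relc δ δ' s * s ^ (-θ) ∧ relc δ δ' s * s ^ (-θ) ≤ 2 ∧ s ^ 2 ≤ ε * ρ ^ 2) :
    nuP d p δ δ' K ≤ C ^ p := by
  have hp0 : 0 < p := by linarith
  obtain ⟨β, M, hβc, hβ0, hβ1, hβ2, hβ3, hM, hM1, hM2⟩ := rel_bump
  set α : ℝ := m / p + θ - 2 with hα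
  have hα0 : 0 < α := by
    have : α = (m + p * θ - 2 * p) / p := by rw [hα]; field_simp
    rw [this]; positivity
  set Λ : ℝ := 8 * M + 2 * Module.finrank ℝ W * M + α + (4 * α + 2 * m + 4 + 2 * (θ + 1)) * M + 4 * M with hΛ
  have hC0 : 0 ≤ C := by
    have : 0 ≤ p - 1 := by linarith
    rw [hC]; positivity
  have key : ∀ τ : ℝ, 0 < τ → τ < 1 → nuP d p δ δ' K ≤ (1 - τ) * (C / (1 - τ)) ^ p + 
      τ * (τ * Λ) ^ p * 2 ^ p * (2 * 2 ^ (Module.finrank ℝ W)) * 2 ^ p := by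
    intro τ h0 h1
    have hε1 : τ ^ 2 ≤ 1 := pow_le_one₀ h0.le h1.le
    obtain ⟨a, ha, ρ, L, hρ, hball, hT⟩ := H (τ ^ 2) (by positivity) hε1
    have := rel_test K hKcl W hW m hm hm1 p δ δ' θ α C hp hθ hα hα0 hC β M hβc hβ0 hβ1 hβ2 hβ3 hM hM1 hM2 (τ ^ 2) τ
      (by positivity) hε1 h0 h1 a ha ρ L hρ hball hT Λ hΛ
    have e : τ ^ 2 * Λ / τ = τ * Λ := by field_simp
    rwa [e] at this
  have hcont : ContinuousAt (fun τ : ℝ => (1 - τ) * (C / (1 - τ)) ^ p + 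
      τ * (τ * Λ) ^ p * 2 ^ p * (2 * 2 ^ (Module.finrank ℝ W)) * 2 ^ p) 0 := by
    have c1 : ContinuousAt (fun τ : ℝ => 1 - τ) 0 := by fun_prop
    have c2 : ContinuousAt (fun τ : ℝ => (C / (1 - τ)) ^ p) 0 :=
      (continuousAt_const.div c1 (by norm_num)).rpow_const (Or.inr hp0.le)
    have c3 : ContinuousAt (fun τ : ℝ => (τ * Λ) ^ p) 0 :=
      (continuousAt_id.mul continuousAt_const).rpow_const (Or.inr hp0.le)
    exact (c1.mul c2).add ((((continuousAt_id.mul c3).mul continuousAt_const).mul continuousAt_const).mul continuousAt_const)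
  have ht := hcont.tendsto.mono_left (nhdsWithin_le_nhds (s := Ioi 0))
  simp only [sub_zero, div_one, one_mul, zero_mul, add_zero] at ht
  refine ge_of_tendsto ht ?_
  filter_upwards [Ioo_mem_nhdsGT (show (0:ℝ) < 1 by norm_num)] with τ hτ
  exact key τ hτ.1 hτ.2

theorem rel_nonempty {d : ℕ} (K : Set (EuclideanSpace ℝ (Fin d))) (hKcl : IsClosed K) (hK : K ≠ univ) :
    ∃ φ : EuclideanSpace ℝ (Fin d) → ℝ, ContDiff ℝ 2 φ ∧ HasCompactSupport φ ∧ tsupport φ ⊆ Kᶜ ∧ φ ≠ 0 := by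
  obtain ⟨x, hx⟩ := (ne_univ_iff_exists_notMem K).1 hK
  obtain ⟨r, hr, hb⟩ := Metric.isOpen_iff.1 hKcl.isOpen_compl x hx
  let f : ContDiffBump x := ⟨r / 4, r / 2, by positivity, by linarith⟩
  refine ⟨f, f.contDiff, f.hasCompactSupport, ?_, ?_⟩
  · rw [f.tsupport_eq]
    exact (Metric.closedBall_subset_ball (by show r / 2 < r; linarith)).trans hb
  · intro h
    have := congrFun h x
    rw [f.one_of_mem_closedBall (Metric.mem_closedBall_self (by show 0 ≤ r / 4; positivity))] at this
    simp at this

/-- relative interior ball -/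
theorem rel_small_ball {d : ℕ} (K : Set (EuclideanSpace ℝ (Fin d))) (hKne : K.Nonempty) (hKconv : Convex ℝ K) :
    ∃ a ∈ K, ∃ ρ : ℝ, 0 < ρ ∧ ∀ w ∈ (affineSpan ℝ K).direction, ‖w‖ ≤ 2 * ρ → a + w ∈ K := by
  obtain ⟨a, ha⟩ := hKne.intrinsicInterior hKconv
  rw [mem_intrinsicInterior] at ha
  obtain ⟨y, hy, rfl⟩ := ha
  rw [mem_interior_iff_mem_nhds, Metric.mem_nhds_iff] at hy
  obtain ⟨r, hr, hb⟩ := hy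
  have hyK : (y : EuclideanSpace ℝ (Fin d)) ∈ K := hb (Metric.mem_ball_self hr)
  refine ⟨y, hyK, r / 4, by positivity, fun w hw hwr => ?_⟩
  have hz : (y : EuclideanSpace ℝ (Fin d)) + w ∈ affineSpan ℝ K := by
    rw [add_comm]
    exact AffineSubspace.vadd_mem_of_mem_direction hw y.2
  have : (⟨y + w, hz⟩ : affineSpan ℝ K) ∈ Metric.ball y r := by
    rw [Metric.mem_ball, Subtype.dist_eq, dist_eq_norm, add_sub_cancel_left]
    linarith
  exact hb this

theorem relc_small {δ δ' s : ℝ} (hs : 0 < s) : relc δ δ' s * s ^ (-δ) = (1 + s) ^ (δ' - δ) := by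
  rw [relc, mul_right_comm, ← Real.rpow_add hs, add_neg_cancel, Real.rpow_zero, one_mul]

theorem relc_large {δ δ' s : ℝ} (hs : 0 < s) : relc δ δ' s * s ^ (-δ') = (1 + s⁻¹) ^ (δ' - δ) := by
  have : 1 + s⁻¹ = (1 + s) * s⁻¹ := by field_simp; ring
  rw [relc, this, Real.mul_rpow (by positivity) (by positivity), Real.inv_rpow hs.le, ← Real.rpow_neg hs.le,
    mul_right_comm, ← Real.rpow_add hs, mul_comm]
  congr 2; ring

theorem rel_one_add (γ : ℝ) : ∀ᶠ x in nhdsWithin (0:ℝ) (Ioi 0), 1 / 2 ≤ (1 + x) ^ γ ∧ (1 + x) ^ γ ≤ 2 := by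
  have hc : ContinuousAt (fun x : ℝ => (1 + x) ^ γ) 0 := 
    ContinuousAt.rpow_const (by fun_prop) (Or.inl (by norm_num))
  have ht := hc.tendsto.mono_left (nhdsWithin_le_nhds (s := Ioi 0))
  simp only [add_zero, Real.one_rpow] at ht
  exact ht.eventually (Icc_mem_nhds (by norm_num) (by norm_num))

theorem rel_T_small (δ δ' ε ρ : ℝ) (hε : 0 < ε) (hρ : 0 < ρ) : ∃ L : ℝ, 
     ∀ s, 0 < s → Real.exp ((L - 2) / ε) ≤ s ^ 2 → s ^ 2 ≤ Real.exp ((L + 2) / ε) → 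
      |relw δ δ' s - δ| ≤ ε ∧ 1 / 2 ≤ relc δ δ' s * s ^ (-δ) ∧ relc δ δ' s * s ^ (-δ) ≤ 2 ∧ s ^ 2 ≤ ε * ρ ^ 2 := by
  have h1 : ∀ᶠ s in nhdsWithin (0:ℝ) (Ioi 0), |relw δ δ' s - δ| ≤ ε := by
    have hc : ContinuousAt (fun s : ℝ => |relw δ δ' s - δ|) 0 := by
      unfold relw
      have : ContinuousAt (fun s : ℝ => s / (1 + s)) 0 := continuousAt_id.div (by fun_prop) (by norm_num)
      exact ((continuousAt_const.add (continuousAt_const.mul this)).sub continuousAt_const).abs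
    have ht := hc.tendsto.mono_left (nhdsWithin_le_nhds (s := Ioi 0))
    have e : |relw δ δ' 0 - δ| = 0 := by simp [relw]
    rw [e] at ht
    exact ht.eventually (Iic_mem_nhds hε)
  have h2 := h1.and (rel_one_add (δ' - δ))
  rw [eventually_nhdsWithin_iff, Metric.eventually_nhds_iff] at h2
  obtain ⟨r, hr, h2⟩ := h2
  obtain ⟨L, hL⟩ : ∃ L : ℝ, Real.exp ((L + 2) / ε) = min ((r / 2) ^ 2) (ε * ρ ^ 2) := by
    refine ⟨ε * Real.log (min ((r / 2) ^ 2) (ε * ρ ^ 2)) - 2, ?_⟩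
    rw [sub_add_cancel, mul_div_cancel_left₀ _ hε.ne', Real.exp_log (by positivity)]
  refine ⟨L, fun s hs _ h => ?_⟩
  rw [hL, le_min_iff] at h
  have hsr : s < r := by
    have := abs_le_of_sq_le_sq h.1 (by positivity)
    have := (abs_le.1 (abs_le_of_sq_le_sq h.1 (by positivity) : |s| ≤ r / 2)).2
    linarith
  obtain ⟨a, b⟩ := h2 (y := s) (by rwa [Real.dist_eq, sub_zero, abs_of_pos hs]) hs
  rw [relc_small hs]
  exact ⟨a, b.1, b.2, h.2⟩

theorem rel_T_large (δ δ' ε : ℝ) (hε : 0 < ε) : ∃ L : ℝ, 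
     ∀ s, 0 < s → Real.exp ((L - 2) / ε) ≤ s ^ 2 → 
      |relw δ δ' s - δ'| ≤ ε ∧ 1 / 2 ≤ relc δ δ' s * s ^ (-δ') ∧ relc δ δ' s * s ^ (-δ') ≤ 2 := by
  have h1 : ∀ᶠ s in nhdsWithin (0:ℝ) (Ioi 0), |(δ - δ') * (s / (1 + s))| ≤ ε := by
    have hc : ContinuousAt (fun s : ℝ => |(δ - δ') * (s / (1 + s))|) 0 := by
      have : ContinuousAt (fun s : ℝ => s / (1 + s)) 0 := continuousAt_id.div (by fun_prop) (by norm_num)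
      exact (continuousAt_const.mul this).abs
    have ht := hc.tendsto.mono_left (nhdsWithin_le_nhds (s := Ioi 0))
    simp only [zero_div, mul_zero, abs_zero] at ht
    exact ht.eventually (Iic_mem_nhds hε)
  have h2 := h1.and (rel_one_add (δ' - δ))
  have h3 := tendsto_inv_atTop_nhdsGT_zero.eventually h2
  obtain ⟨R, hR⟩ := eventually_atTop.1 h3
  set R' := max R 1
  have hR' : 0 < R' := by positivity
  obtain ⟨L, hL⟩ : ∃ L : ℝ, Real.exp ((L - 2) / ε) = R' ^ 2 := by
    refine ⟨ε * Real.log (R' ^ 2) + 2, ?_⟩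
    rw [add_sub_cancel_right, mul_div_cancel_left₀ _ hε.ne', Real.exp_log (by positivity)]
  refine ⟨L, fun s hs h => ?_⟩
  rw [hL] at h
  have hsr : R' ≤ s := by
    have := (abs_le.1 (abs_le_of_sq_le_sq h hs.le)).2
    linarith
  obtain ⟨a, b⟩ := hR s ((le_max_left _ _).trans hsr)
  rw [relc_large hs]
  refine ⟨?_, b.1, b.2⟩
  convert a using 2
  unfold relw; field_simp; ring


theorem rel_simplex {V : Type*} [NormedAddCommGroup V] [InnerProductSpace ℝ V] [FiniteDimensional ℝ V]
    [MeasurableSpace V] [BorelSpace V] (μ : Measure V) [μ.IsAddHaarMeasure] (k : ℕ) (hk : Module.finrank ℝ V = k) (hk1 : 1 ≤ k)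
    (S : Set V) (hS : IsCompact S) (hSc : Convex ℝ S) (r r0 R : ℝ) (hr0 : 0 < r0) (hr : 0 < r) (hR : 0 ≤ R)
    (hSr : S ⊆ Metric.closedBall 0 r) (hSr0 : Metric.closedBall 0 r0 ⊆ S)
    (hμ : 2 * k * (μ (Metric.closedBall (0:V) k)).toReal * R * r ^ (k - 1) ≤ (μ S).toReal) :
    ∃ g, ∀ u, ‖u‖ ≤ R → g + u ∈ S := by
  subst hk
  set k := Module.finrank ℝ V with hk
  haveI : Fact (Module.finrank ℝ V = k) := ⟨rfl⟩
  have h0S : (0:V) ∈ S := hSr0 (Metric.mem_closedBall_self hr0.le)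
  let b : OrthonormalBasis (Fin k) ℝ V := stdOrthonormalBasis ℝ V
  have hbdet : ∀ v : Fin k → V, |b.toBasis.det v| ≤ ∏ i, ‖v i‖ := by
    intro v
    have h := Orientation.abs_volumeForm_apply_le (b.toBasis.orientation) v
    rwa [Orientation.volumeForm_robust _ b rfl] at h
  have hcont : Continuous fun v : Fin k → V => |b.toBasis.det v| := by
    have hc : Continuous fun v : Fin k → V => b.toBasis.det v := by
      simp only [Module.Basis.det_apply]
      refine Continuous.matrix_det (continuous_pi fun i => continuous_pi fun j => ?_)
      exact (LinearMap.continuous_of_finiteDimensional (b.toBasis.coord i)).comp (continuous_apply j)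
    exact hc.abs
  obtain ⟨v, hvS, hmax⟩ := (isCompact_univ_pi fun _ : Fin k => hS).exists_isMaxOn ⟨fun _ => 0, fun _ _ => h0S⟩ hcont.continuousOn
  have hvS' : ∀ i, v i ∈ S := fun i => hvS i (mem_univ i)
  set D := b.toBasis.det v with hD
  have hDpos : 0 < |D| := by
    have h1 : (fun i => r0 • b.toBasis i) ∈ univ.pi fun _ : Fin k => S := fun i _ => hSr0 (by
      simp [norm_smul, abs_of_pos hr0])
    have h2 : |b.toBasis.det (fun i => r0 • b.toBasis i)| ≤ |D| := hmax h1
    rw [AlternatingMap.map_smul_univ, Module.Basis.det_self] at h2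
    refine lt_of_lt_of_le ?_ h2
    simp only [Finset.prod_const, smul_eq_mul, mul_one]
    positivity
  have hD0 : D ≠ 0 := abs_pos.1 hDpos
  obtain ⟨hli, hsp⟩ := (b.toBasis.is_basis_iff_det).2 (isUnit_iff_ne_zero.2 hD0)
  set B := Module.Basis.mk hli hsp.ge with hB
  have hBv : ∀ i, B i = v i := fun i => by rw [hB, Module.Basis.mk_apply]
  have hcoord : ∀ i u, D * B.repr u i = b.toBasis.det (Function.update v i u) := by
    intro i u
    have := congrArg (fun l => l u) (b.toBasis.det_smul_mk_coord_eq_det_update hli hsp.ge i)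
    exact this
  -- S is in the image of a ball
  have hvol : (μ S).toReal ≤ |D| * (μ (Metric.closedBall (0:V) k)).toReal := by
    let T : V →ₗ[ℝ] V := b.toBasis.constr ℝ v
    have hT : LinearMap.det T = D := by
      have := b.toBasis.det_comp T b.toBasis
      rw [Module.Basis.det_self, mul_one] at this
      rw [← this, hD]; congr 1; ext i
      simp only [T, Function.comp, Module.Basis.constr_basis]
    have hsub : S ⊆ T '' Metric.closedBall 0 k := by
      intro u hu
      refine ⟨∑ i, B.repr u i • b.toBasis i, ?_, ?_⟩
      · rw [mem_closedBall_zero_iff]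
        refine (norm_sum_le _ _).trans ?_
        have : ∀ i ∈ Finset.univ, ‖B.repr u i • b.toBasis i‖ ≤ 1 := by
          intro i _
          have h1 : Function.update v i u ∈ univ.pi fun _ : Fin k => S := by
            intro j _
            by_cases h : j = i
            · subst h; simpa using hu
            · simpa [h] using hvS' j
          have h2 : |b.toBasis.det (Function.update v i u)| ≤ |D| := hmax h1
          rw [← hcoord, abs_mul] at h2
          have h3 : |B.repr u i| ≤ 1 := by
            by_contra h; push Not at h; nlinarith
          rw [norm_smul, Real.norm_eq_abs]; simpa using h3
        refine (Finset.sum_le_sum this).trans ?_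
        simp
      · rw [map_sum]
        conv_rhs => rw [← B.sum_repr u]
        refine Finset.sum_congr rfl fun i _ => ?_
        rw [map_smul, hBv]
        simp only [T, Module.Basis.constr_basis]
    have h := measure_mono (μ := μ) hsub
    rw [Measure.addHaar_image_linearMap, hT] at h
    have hfin : μ (Metric.closedBall (0:V) k) ≠ ⊤ := (isCompact_closedBall _ _).measure_lt_top.ne
    have := ENNReal.toReal_mono (ENNReal.mul_ne_top ENNReal.ofReal_ne_top hfin) h
    rwa [ENNReal.toReal_mul, ENNReal.toReal_ofReal (abs_nonneg _)] at this
  have hkpos : (0:ℝ) < k := by exact_mod_cast hk1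
  have hC1 : 0 < (μ (Metric.closedBall (0:V) k)).toReal :=
    ENNReal.toReal_pos (Metric.measure_closedBall_pos μ _ hkpos).ne' (isCompact_closedBall _ _).measure_lt_top.ne
  have hDR : 2 * k * R * r ^ (k - 1) ≤ |D| := by
    have := hμ.trans hvol
    refine le_of_mul_le_mul_right ?_ hC1
    linarith
  refine ⟨∑ i, (1 / (2 * k) : ℝ) • v i, fun u hu => ?_⟩
  have hc : ∀ i, |B.repr u i| ≤ 1 / (2 * k) := by
    intro i
    have h1 := hbdet (Function.update v i u)
    rw [← hcoord, abs_mul] at h1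
    have h2 : ∏ j, ‖Function.update v i u j‖ ≤ R * r ^ (k - 1) := by
      have e : (fun j => ‖Function.update v i u j‖) = Function.update (fun j => ‖v j‖) i ‖u‖ := by
        ext j
        by_cases h : j = i
        · subst h; simp
        · simp [h]
      rw [e, Finset.prod_update_of_mem (Finset.mem_univ i)]
      have h3 : ∏ x ∈ Finset.univ \ {i}, ‖v x‖ ≤ ∏ x ∈ Finset.univ \ {i}, r :=
        Finset.prod_le_prod (fun _ _ => norm_nonneg _) fun j _ => mem_closedBall_zero_iff.1 (hSr (hvS' j))
      rw [Finset.prod_const, Finset.card_sdiff_of_subset (by simp), Finset.card_singleton, Finset.card_univ, Fintype.card_fin] at h3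
      exact mul_le_mul hu h3 (Finset.prod_nonneg fun _ _ => norm_nonneg _) hR
    rw [le_div_iff₀ (by positivity)]
    have h4 : |D| * |B.repr u i| * (2 * k) ≤ |D| := by
      have := h1.trans h2
      nlinarith
    nlinarith
  have e : ∑ i, (1 / (2 * k) : ℝ) • v i + u = ∑ i, (1 / (2 * k) + B.repr u i) • v i := by
    conv_lhs => rw [← B.sum_repr u]
    rw [← Finset.sum_add_distrib]
    refine Finset.sum_congr rfl fun i _ => ?_
    rw [hBv, add_smul]
  rw [e]
  set c : Fin k → ℝ := fun i => 1 / (2 * k) + B.repr u i with hcdef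
  have hcn : ∀ i, 0 ≤ c i := fun i => by have := abs_le.1 (hc i); simp only [hcdef]; linarith
  have hc1 : ∑ i, c i ≤ 1 := by
    have : ∀ i ∈ Finset.univ, c i ≤ 1 / k := fun i _ => by
      have := abs_le.1 (hc i); simp only [hcdef]
      have e : (1:ℝ) / k = 1 / (2 * k) + 1 / (2 * k) := by field_simp; norm_num
      linarith
    refine (Finset.sum_le_sum this).trans ?_
    simp [hkpos.ne']
  have hzero := hSc.sum_mem (t := Finset.univ) (w := fun o : Option (Fin k) => o.elim (1 - ∑ i, c i) c) (z := fun o => o.elim 0 v)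
    (by rintro (_ | i) _
        · simpa using hc1
        · exact hcn i)
    (by rw [Fintype.sum_option]; simp)
    (by rintro (_ | i) _
        · exact h0S
        · exact hvS' i)
  rw [Fintype.sum_option] at hzero
  simpa only [Option.elim, smul_zero, zero_add] using hzero

theorem rel_liminf_vol (f : ℝ → ℝ) (hf : ∀ r, 0 ≤ f r) (k : ℕ) (hk : 1 ≤ k)
    (h : Filter.liminf (fun r : ℝ => Real.log (f r) / Real.log r) Filter.atTop = (k : ℝ)) :
    ∀ᶠ r in atTop, r ^ ((k : ℝ) - 1 / 2) ≤ f r := by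
  rw [liminf_eq] at h
  have hk' : (1:ℝ) ≤ k := by exact_mod_cast hk
  have hne : {a : ℝ | ∀ᶠ r in atTop, a ≤ Real.log (f r) / Real.log r}.Nonempty := by
    by_contra hn
    rw [not_nonempty_iff_eq_empty] at hn
    rw [hn, Real.sSup_empty] at h
    linarith
  obtain ⟨a, ha, hka⟩ := exists_lt_of_lt_csSup hne (show (k:ℝ) - 1 / 2 < _ by rw [h]; linarith)
  filter_upwards [ha, eventually_gt_atTop 1] with r h1 hr
  have hl : 0 < Real.log r := Real.log_pos hr
  rw [le_div_iff₀ hl] at h1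
  have hpos : 0 < f r := by
    refine lt_of_le_of_ne (hf r) fun h0 => ?_
    rw [← h0, Real.log_zero] at h1
    have : 0 < a * Real.log r := mul_pos (by linarith) hl
    linarith
  rw [← Real.log_le_log_iff (by positivity) hpos, Real.log_rpow (by linarith)]
  refine le_trans ?_ h1
  gcongr

theorem rel_big_ball {d : ℕ} (K : Set (EuclideanSpace ℝ (Fin d))) (hKne : K.Nonempty) (hKcl : IsClosed K) (hKconv : Convex ℝ K)
    (k : ℕ) (hk : Module.finrank ℝ (affineSpan ℝ K).direction = k) (hk1 : 1 ≤ k) 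
    (h : Filter.liminf
        (fun r : ℝ =>
          Real.log ((μH[(k : ℝ)] (K ∩ Metric.ball 0 r)).toReal) / Real.log r)
        Filter.atTop = (k : ℝ)) (R : ℝ) (hR : 0 ≤ R) :
    ∃ a ∈ K, ∀ w ∈ (affineSpan ℝ K).direction, ‖w‖ ≤ R → a + w ∈ K := by
  obtain ⟨a, ha, ρ, hρ, hball⟩ := rel_small_ball K hKne hKconv
  set W := (affineSpan ℝ K).direction with hW
  have hvol := rel_liminf_vol _ (fun _ => ENNReal.toReal_nonneg) k hk1 h
  set C1 := (μH[(k : ℝ)] (Metric.closedBall (0:W) k)).toReal with hC1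
  haveI : (μH[(k : ℝ)] : Measure W).IsAddHaarMeasure := by
    have := isAddHaarMeasure_hausdorffMeasure (E := W)
    rwa [hk] at this
  have hev : ∀ᶠ r : ℝ in atTop, 2 * k * C1 * R * (2 * r) ^ (k - 1) ≤ r ^ ((k : ℝ) - 1 / 2) := by
    have h1 : ∀ᶠ r : ℝ in atTop, 2 * k * C1 * R * 2 ^ (k - 1) ≤ r ^ ((1:ℝ) / 2) :=
      (tendsto_rpow_atTop (by norm_num)).eventually_ge_atTop _
    filter_upwards [h1, eventually_gt_atTop 0] with r h1 hr
    have e : r ^ ((k : ℝ) - 1 / 2) = r ^ ((1:ℝ) / 2) * r ^ (k - 1) := by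
      rw [← Real.rpow_natCast, ← Real.rpow_add hr]
      congr 1
      rw [Nat.cast_sub hk1]; push_cast; ring
    rw [e, mul_pow, ← mul_assoc]
    gcongr
  obtain ⟨r, h1, h2, hra, hrρ⟩ := (hvol.and (hev.and ((eventually_ge_atTop ‖a‖).and (eventually_ge_atTop ρ)))).exists
  have hr : 0 < r := by linarith
  let ι : W → EuclideanSpace ℝ (Fin d) := fun w => a + w
  have hι : Isometry ι := Isometry.of_dist_eq fun x y => by simp [ι, Subtype.dist_eq]
  have hιc : Continuous ι := hι.continuous
  set S : Set W := ι ⁻¹' K ∩ Metric.closedBall 0 (2 * r) with hS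
  have hScomp : IsCompact S := (isCompact_closedBall _ _).inter_left (hKcl.preimage hιc)
  have hSconv : Convex ℝ S := by
    refine Convex.inter ?_ (convex_closedBall _ _)
    intro x hx y hy s t hs ht hst
    have := hKconv hx hy hs ht hst
    show ι _ ∈ K
    convert this using 1
    simp only [ι, Submodule.coe_add, Submodule.coe_smul]
    rw [smul_add, smul_add, add_add_add_comm, ← add_smul, hst, one_smul]
  have hSvol : (μH[(k : ℝ)] (K ∩ Metric.ball 0 r)).toReal ≤ (μH[(k : ℝ)] S).toReal := by
    refine ENNReal.toReal_mono hScomp.measure_lt_top.ne ?_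
    rw [← hι.hausdorffMeasure_image (Or.inl (Nat.cast_nonneg k)) S]
    refine measure_mono fun x hx => ?_
    have hxa : x - a ∈ W := AffineSubspace.vsub_mem_direction (subset_affineSpan ℝ K hx.1) (subset_affineSpan ℝ K ha)
    refine ⟨⟨x - a, hxa⟩, ⟨?_, ?_⟩, ?_⟩
    · show a + (x - a) ∈ K
      rw [add_sub_cancel]; exact hx.1
    · rw [mem_closedBall_zero_iff]
      show ‖x - a‖ ≤ 2 * r
      have := mem_ball_zero_iff.1 hx.2
      linarith [norm_sub_le x a]
    · show a + (x - a) = x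
      abel
  obtain ⟨g, hg⟩ := rel_simplex (μH[(k : ℝ)] : Measure W) k hk hk1 S hScomp hSconv (2 * r) ρ R hρ (by positivity) hR inter_subset_right
    (fun w hw => ⟨hball w w.2 (by have : ‖w‖ ≤ ρ := mem_closedBall_zero_iff.1 hw
                                  show ‖w‖ ≤ 2 * ρ
                                  linarith), Metric.closedBall_subset_closedBall (by linarith) hw⟩) (h2.trans (h1.trans hSvol))
  refine ⟨a + g, ?_, fun w hw hwR => ?_⟩
  · have := (hg 0 (by simpa using hR)).1
    rw [add_zero] at this; exact this
  · have := (hg ⟨w, hw⟩ hwR).1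
    rw [add_assoc]; exact this

/-- Upper bounds and optimality for the Rellich constant on the complement of a convex
set of dimension `k < d` (Theorem 4.8 of the paper). -/
theorem rellich_optimal_constant_bounds
    (d k : ℕ) (hd : 1 ≤ d) (K : Set (EuclideanSpace ℝ (Fin d)))
    (hKne : K.Nonempty) (hKcl : IsClosed K) (hKconv : Convex ℝ K)
    (hKproper : K ≠ Set.univ)
    (hk : Module.finrank ℝ (affineSpan ℝ K).direction = k)
    (hk1 : 1 ≤ k) (hkd : k ≤ d - 1)
    (p δ δ' : ℝ) (hp : 1 < p) (hδ : 0 ≤ δ) (hδ' : 0 ≤ δ') :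
    (0 < (d : ℝ) - k + p * δ - 2 * p →
      nuP d p δ δ' K ≤
        ((p - 1) * ((d : ℝ) - k) * ((d : ℝ) - k + p * δ - 2 * p) / p ^ 2) ^ p) ∧
    (Filter.liminf
        (fun r : ℝ =>
          Real.log ((μH[(k : ℝ)] (K ∩ Metric.ball 0 r)).toReal) / Real.log r)
        Filter.atTop = (k : ℝ) →
      0 < (d : ℝ) - k + p * min δ δ' - 2 * p →
      nuP d p δ δ' K ≤
        ((p - 1) * ((d : ℝ) - k) * ((d : ℝ) - k + p * min δ δ' - 2 * p) / p ^ 2) ^ p) ∧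
    (Filter.liminf
        (fun r : ℝ =>
          Real.log ((μH[(k : ℝ)] (K ∩ Metric.ball 0 r)).toReal) / Real.log r)
        Filter.atTop = (k : ℝ) →
      δ = δ' → δ < 2 → 0 < (d : ℝ) - k + p * δ - 2 * p →
      nuP d p δ δ' K =
        ((p - 1) * ((d : ℝ) - k) * ((d : ℝ) - k + p * δ - 2 * p) / p ^ 2) ^ p) := by
  have hp0 : 0 < p := by linarith
  set W := (affineSpan ℝ K).direction with hW
  have hm : Module.finrank ℝ Wᗮ = d - k := by
    have := W.finrank_add_finrank_orthogonal
    rw [finrank_euclideanSpace_fin, hk] at this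
    omega
  have hm1 : 1 ≤ d - k := by omega
  have hmc : ((d - k : ℕ) : ℝ) = (d : ℝ) - k := by
    rw [Nat.cast_sub (by omega)]
  have part1 : 0 < (d : ℝ) - k + p * δ - 2 * p →
      nuP d p δ δ' K ≤
        ((p - 1) * ((d : ℝ) - k) * ((d : ℝ) - k + p * δ - 2 * p) / p ^ 2) ^ p := by
    intro hN
    refine rel_upper K hKcl W hW (d - k) hm hm1 p δ δ' δ _ hp hδ (by rw [hmc]; exact hN) (by rw [hmc]) ?_
    intro ε hε _
    obtain ⟨a, ha, ρ, hρ, hball⟩ := rel_small_ball K hKne hKconv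
    obtain ⟨L, hL⟩ := rel_T_small δ δ' ε ρ hε hρ
    exact ⟨a, ha, ρ, L, hρ, hball, hL⟩
  refine ⟨part1, ?_, ?_⟩
  · intro hlim hN
    rcases le_total δ δ' with hle | hle
    · rw [min_eq_left hle] at hN ⊢
      exact part1 hN
    · rw [min_eq_right hle] at hN ⊢
      refine rel_upper K hKcl W hW (d - k) hm hm1 p δ δ' δ' _ hp hδ' (by rw [hmc]; exact hN) (by rw [hmc]) ?_
      intro ε hε _
      obtain ⟨L, hL⟩ := rel_T_large δ δ' ε hε
      set ρ : ℝ := Real.sqrt (Real.exp ((L + 2) / ε) / ε) with hρd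
      have hρ : 0 < ρ := Real.sqrt_pos.2 (by positivity)
      obtain ⟨a, ha, hball⟩ := rel_big_ball K hKne hKcl hKconv k hk hk1 hlim (2 * ρ) (by positivity)
      refine ⟨a, ha, ρ, L, hρ, hball, fun s hs h1 h2 => ?_⟩
      obtain ⟨b1, b2, b3⟩ := hL s hs h1
      refine ⟨b1, b2, b3, ?_⟩
      rw [hρd, Real.sq_sqrt (by positivity), mul_div_cancel₀ _ hε.ne']
      exact h2
  · intro _ hδδ hδ2 hN
    refine le_antisymm (part1 hN) ?_
    subst hδδ
    obtain ⟨φ, h1, h2, h3, h4⟩ := rel_nonempty K hKcl hKproper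
    refine le_csInf ⟨_, φ, h1, h2, h3, h4, rfl⟩ ?_
    rintro r ⟨ψ, g1, g2, g3, g4, rfl⟩
    have hkd' : (0:ℝ) < (d : ℝ) - k := by rw [← hmc]; exact_mod_cast hm1
    exact rel_lower K hKcl hKne hKconv p δ ((d : ℝ) - k) _ hp hδ2 (by rw [hk]) hkd' hN rfl ψ g1 g2 g3 g4
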